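/- Under Assumptions 1–4 (noise, connectivity, objective functions, step sizes), for the dynamics x_i(t+1) = (1-β(t))x_i(t) + β(t)(Σ_{j=1}^n W_{ij}(t)x_j(t) + e_i(t)) − α(t)g_i(x_i(t)), the state of every agent i ∈ {1,…,n} converges almost surely to a common random point x̃ that lies in the optimizer set X* = argmin_{x∈ℝ^d} Σ_{i=1}^n r_i f_i(x). -/

import Mathlib

open MeasureTheory Filter
open scoped RealInnerProductSpace

section Convex

variable {E : Type*} [NormedAddCommGroup E] [InnerProductSpace ℝ E] [FiniteDimensional ℝ E]

/-- A finite convex function on a finite-dimensional space has a subgradient at every point. -/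
theorem ConvexOn.exists_subgradient {f : E → ℝ} (hf : ConvexOn ℝ Set.univ f) (p : E) :
    ∃ v : E, ∀ y, f p + ⟪v, y - p⟫ ≤ f y := by
  have hcont : Continuous f := hf.locallyLipschitz.continuous
  have hopen : IsOpen {q : E × ℝ | q.1 ∈ Set.univ ∧ f q.1 < q.2} := by
    simpa using isOpen_lt (hcont.comp continuous_fst) continuous_snd
  obtain ⟨φ, hφ⟩ := geometric_hahn_banach_open_point hf.convex_strict_epigraph hopen
    (x := (p, f p)) (by simp)
  have hsplit : ∀ (y : E) (s : ℝ), φ (y, s) = φ (y, 0) + s * φ (0, 1) := by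
    intro y s
    rw [← smul_eq_mul, ← map_smul, ← map_add]
    simp
  set c := φ (0, 1) with hc
  have hc_neg : c < 0 := by
    have h := hφ (p, f p + 1) (by simp)
    rw [hsplit p (f p + 1), hsplit p (f p)] at h
    linarith
  have hle : ∀ y, φ (y, 0) + f y * c ≤ φ (p, 0) + f p * c := by
    intro y
    refine le_of_forall_pos_le_add fun ε hε => ?_
    have h := hφ (y, f y + ε / (-c)) (by simpa using div_pos hε (neg_pos.2 hc_neg))
    rw [hsplit y, hsplit p (f p)] at h
    have : ε / (-c) * c = -ε := by
      rw [div_neg, neg_mul, div_mul_cancel₀ _ hc_neg.ne]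
    nlinarith
  let ℓ : E →L[ℝ] ℝ := φ.comp (ContinuousLinearMap.inl ℝ E ℝ)
  refine ⟨(InnerProductSpace.toDual ℝ E).symm ((-c)⁻¹ • ℓ), fun y => ?_⟩
  rw [InnerProductSpace.toDual_symm_apply]
  have hℓ : ℓ (y - p) = φ (y, 0) - φ (p, 0) := by
    rw [map_sub]; simp [ℓ]
  rw [smul_apply, hℓ, smul_eq_mul, inv_mul_eq_div]
  have hpos : 0 < -c := neg_pos.2 hc_neg
  rw [← le_sub_iff_add_le', div_le_iff₀ hpos]
  nlinarith [hle y]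

/-- A convex function all of whose subgradients have norm less than `L` decreases at rate at
most `L`. -/
theorem ConvexOn.sub_mul_norm_le_of_subgradient_lt {f : E → ℝ} (hf : ConvexOn ℝ Set.univ f) {L : ℝ}
    (hL : ∀ p v : E, (∀ y, f p + ⟪v, y - p⟫ ≤ f y) → ‖v‖ < L) (p y : E) :
    f p - L * ‖y - p‖ ≤ f y := by
  obtain ⟨v, hv⟩ := hf.exists_subgradient p
  have h1 := neg_le_of_abs_le (abs_real_inner_le_norm v (y - p))
  have h2 := mul_le_mul_of_nonneg_right (hL p v hv).le (norm_nonneg (y - p))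
  linarith [hv y]

end Convex

section WeightedMean

variable {ι E : Type*} [Fintype ι] [NormedAddCommGroup E] [InnerProductSpace ℝ E]

/-- The `r`-weighted mean of a family of vectors. -/
def weightedMean (r : ι → ℝ) (x : ι → E) : E := ∑ i, r i • x i

/-- The `r`-weighted mean square distance to the weighted mean. -/
def dispersion (r : ι → ℝ) (x : ι → E) : ℝ := ∑ i, r i * ‖x i - weightedMean r x‖ ^ 2

/-- The weighted sum of squared differences across the edges of `W`. -/
def edgeEnergy (r : ι → ℝ) (W : Matrix ι ι ℝ) (x : ι → E) : ℝ :=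
  ∑ i, r i * ∑ j, W i j * ‖x j - x i‖ ^ 2

/-- The state after one lazy averaging step with weights `W` and laziness `1 - b`. -/
def lazyAverage (b : ℝ) (W : Matrix ι ι ℝ) (x : ι → E) (i : ι) : E :=
  (1 - b) • x i + b • ∑ j, W i j • x j

theorem dispersion_nonneg {r : ι → ℝ} (hr : ∀ i, 0 ≤ r i) (x : ι → E) : 0 ≤ dispersion r x :=
  Finset.sum_nonneg fun i _ => mul_nonneg (hr i) (sq_nonneg _)

theorem edgeEnergy_nonneg {E : Type*} [NormedAddCommGroup E]
    {r : ι → ℝ} (hr : ∀ i, 0 ≤ r i) {W : Matrix ι ι ℝ}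
    (hW : ∀ i j, 0 ≤ W i j) (x : ι → E) : 0 ≤ edgeEnergy r W x :=
  Finset.sum_nonneg fun i _ => mul_nonneg (hr i) <|
    Finset.sum_nonneg fun j _ => mul_nonneg (hW i j) (sq_nonneg _)

/-- The parallel axis identity. -/
theorem sum_mul_norm_sub_sq {r : ι → ℝ} (hs : ∑ i, r i = 1) (x : ι → E) (c : E) :
    ∑ i, r i * ‖x i - c‖ ^ 2 = dispersion r x + ‖weightedMean r x - c‖ ^ 2 := by
  set m := weightedMean r x with hm
  have h0 : ∑ i, r i * ⟪x i - m, m - c⟫ = 0 := by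
    have : ∑ i, r i • (x i - m) = 0 := by
      simp only [smul_sub, Finset.sum_sub_distrib, ← Finset.sum_smul, hs, one_smul]
      rw [hm, weightedMean, sub_self]
    calc ∑ i, r i * ⟪x i - m, m - c⟫ = ⟪∑ i, r i • (x i - m), m - c⟫ := by
          simp [sum_inner, real_inner_smul_left]
      _ = 0 := by rw [this, inner_zero_left]
  have hexp : ∀ i, r i * ‖x i - c‖ ^ 2
      = r i * ‖x i - m‖ ^ 2 + 2 * (r i * ⟪x i - m, m - c⟫) + r i * ‖m - c‖ ^ 2 := by
    intro i
    rw [← sub_add_sub_cancel (x i) m c, norm_add_sq_real]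
    ring
  simp only [hexp, Finset.sum_add_distrib, ← Finset.mul_sum, ← Finset.sum_mul, h0, hs]
  simp [dispersion, ← hm]

theorem dispersion_le_sum {r : ι → ℝ} (hs : ∑ i, r i = 1) (x : ι → E) (c : E) :
    dispersion r x ≤ ∑ i, r i * ‖x i - c‖ ^ 2 := by
  rw [sum_mul_norm_sub_sq hs]
  exact le_add_of_nonneg_right (sq_nonneg _)

theorem norm_sum_smul_sub_sq_le {r : ι → ℝ} (hr : ∀ i, 0 ≤ r i) (hs : ∑ i, r i = 1)
    (x : ι → E) (c : E) : ‖∑ i, r i • x i - c‖ ^ 2 ≤ ∑ i, r i * ‖x i - c‖ ^ 2 := by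
  rw [sum_mul_norm_sub_sq hs]
  exact le_add_of_nonneg_left (dispersion_nonneg hr x)

theorem norm_sum_smul_sq_le {r : ι → ℝ} (hr : ∀ i, 0 ≤ r i) (hs : ∑ i, r i = 1)
    (x : ι → E) : ‖∑ i, r i • x i‖ ^ 2 ≤ ∑ i, r i * ‖x i‖ ^ 2 := by
  simpa using norm_sum_smul_sub_sq_le hr hs x 0

theorem norm_sub_sq_le_two_mul {E : Type*} [NormedAddCommGroup E] (u v : E) :
    ‖u - v‖ ^ 2 ≤ 2 * ‖u‖ ^ 2 + 2 * ‖v‖ ^ 2 := by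
  nlinarith [norm_sub_le u v, norm_nonneg (u - v), sq_nonneg (‖u‖ - ‖v‖), norm_nonneg u,
    norm_nonneg v]

theorem two_mul_le_mul_sq_add {c : ℝ} (hc : 0 < c) (a b : ℝ) :
    2 * a * b ≤ c * b ^ 2 + a ^ 2 / c := by
  have h : c * b ^ 2 + a ^ 2 / c - 2 * a * b = (c * b - a) ^ 2 / c := by
    field_simp
    ring
  have := div_nonneg (sq_nonneg (c * b - a)) hc.le
  linarith

variable {r : ι → ℝ} {W : Matrix ι ι ℝ}

theorem sum_mul_sum_eq_of_vecMul_eq (hWr : ∀ j, ∑ i, r i * W i j = r j) (h : ι → ℝ) :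
    ∑ i, r i * ∑ j, W i j * h j = ∑ j, r j * h j := by
  simp only [Finset.mul_sum]
  rw [Finset.sum_comm]
  refine Finset.sum_congr rfl fun j _ => ?_
  rw [← hWr j, Finset.sum_mul]
  exact Finset.sum_congr rfl fun i _ => by ring

theorem weightedMean_mulVec (hWr : ∀ j, ∑ i, r i * W i j = r j) (x : ι → E) :
    weightedMean r (fun i => ∑ j, W i j • x j) = weightedMean r x := by
  simp only [weightedMean, Finset.smul_sum, smul_smul]
  rw [Finset.sum_comm]
  refine Finset.sum_congr rfl fun j _ => ?_
  rw [← Finset.sum_smul, hWr j]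

/-- A lazy averaging step decreases the dispersion around any point by a multiple of the edge
energy. -/
theorem sum_lazyAverage_le (hr : ∀ i, 0 ≤ r i) (hW : ∀ i j, 0 ≤ W i j)
    (hrow : ∀ i, ∑ j, W i j = 1) (hWr : ∀ j, ∑ i, r i * W i j = r j) (b : ℝ)
    (x : ι → E) (c : E) :
    ∑ i, r i * ‖lazyAverage b W x i - c‖ ^ 2
      ≤ ∑ i, r i * ‖x i - c‖ ^ 2 - b * (1 - b) * edgeEnergy r W x := by
  have hmix : ∀ u v : E, ‖(1 - b) • u + b • v - c‖ ^ 2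
      = (1 - b) * ‖u - c‖ ^ 2 + b * ‖v - c‖ ^ 2 - b * (1 - b) * ‖v - u‖ ^ 2 := by
    intro u v
    have h1 : (1 - b) • u + b • v - c = (u - c) + b • (v - u) := by module
    have h2 : v - c = (u - c) + (v - u) := by abel
    rw [h1, h2, norm_add_sq_real, norm_add_sq_real, norm_smul, inner_smul_right, mul_pow,
      Real.norm_eq_abs, sq_abs]
    ring
  have hi : ∀ i, ‖lazyAverage b W x i - c‖ ^ 2 ≤ (1 - b) * ‖x i - c‖ ^ 2
      + b * ∑ j, W i j * ‖x j - c‖ ^ 2 - b * (1 - b) * ∑ j, W i j * ‖x j - x i‖ ^ 2 := by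
    intro i
    have h1 : lazyAverage b W x i = ∑ j, W i j • ((1 - b) • x i + b • x j) := by
      simp only [lazyAverage, smul_add, Finset.sum_add_distrib, ← Finset.sum_smul, hrow, one_smul,
        Finset.smul_sum, smul_comm b]
    rw [h1]
    refine (norm_sum_smul_sub_sq_le (hW i) (hrow i) _ c).trans (le_of_eq ?_)
    have h2 : (1 - b) * ‖x i - c‖ ^ 2 = ∑ j, W i j * ((1 - b) * ‖x i - c‖ ^ 2) := by
      rw [← Finset.sum_mul, hrow, one_mul]
    rw [h2, Finset.mul_sum, Finset.mul_sum, ← Finset.sum_add_distrib, ← Finset.sum_sub_distrib]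
    exact Finset.sum_congr rfl fun j _ => by rw [hmix]; ring
  calc ∑ i, r i * ‖lazyAverage b W x i - c‖ ^ 2
      ≤ ∑ i, r i * ((1 - b) * ‖x i - c‖ ^ 2
        + b * ∑ j, W i j * ‖x j - c‖ ^ 2 - b * (1 - b) * ∑ j, W i j * ‖x j - x i‖ ^ 2) :=
        Finset.sum_le_sum fun i _ => mul_le_mul_of_nonneg_left (hi i) (hr i)
    _ = (1 - b) * ∑ i, r i * ‖x i - c‖ ^ 2 + b * ∑ i, r i * ∑ j, W i j * ‖x j - c‖ ^ 2
        - b * (1 - b) * edgeEnergy r W x := by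
        rw [edgeEnergy, Finset.mul_sum, Finset.mul_sum, Finset.mul_sum, ← Finset.sum_add_distrib,
          ← Finset.sum_sub_distrib]
        exact Finset.sum_congr rfl fun i _ => by ring
    _ = _ := by
        rw [sum_mul_sum_eq_of_vecMul_eq hWr]
        ring

end WeightedMean

section PerturbedStep

variable {ι E : Type*} [Fintype ι] [NormedAddCommGroup E] [InnerProductSpace ℝ E]
  {r : ι → ℝ} {W : Matrix ι ι ℝ} {a b L : ℝ} {x x' e g : ι → E}

theorem norm_smul_sub_smul_sq_le (u v : E) (hv : ‖v‖ ≤ L) :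
    ‖b • u - a • v‖ ^ 2 ≤ 2 * b ^ 2 * ‖u‖ ^ 2 + 2 * L ^ 2 * a ^ 2 := by
  have h1 := norm_sub_sq_le_two_mul (b • u) (a • v)
  have h2 : ‖v‖ ^ 2 ≤ L ^ 2 := pow_le_pow_left₀ (norm_nonneg v) hv 2
  rw [norm_smul, norm_smul, mul_pow, mul_pow, Real.norm_eq_abs, Real.norm_eq_abs, sq_abs,
    sq_abs] at h1
  nlinarith [mul_le_mul_of_nonneg_left h2 (sq_nonneg a)]

/-- One-step estimate for the dispersion under lazy averaging perturbed by noise `e` and a bounded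
drift `g`. -/
theorem dispersion_step_le (hr : ∀ i, 0 ≤ r i) (hs : ∑ i, r i = 1) (hW : ∀ i j, 0 ≤ W i j)
    (hrow : ∀ i, ∑ j, W i j = 1) (hWr : ∀ j, ∑ i, r i * W i j = r j)
    (ha : 0 ≤ a) (hb : 0 < b) (hb' : b ≤ 1 / 2) (hg : ∀ i, ‖g i‖ ≤ L)
    (hx' : ∀ i, x' i = lazyAverage b W x i + b • e i - a • g i) {ε : ℝ} (hε : 0 < ε) :
    dispersion r x' ≤ dispersion r x - b / 2 * edgeEnergy r W x
      + (ε * (b * dispersion r x) + L ^ 2 / ε * (a ^ 2 / b)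
        + 2 * b ^ 2 * ∑ i, r i * ‖e i‖ ^ 2 + 2 * L ^ 2 * a ^ 2)
      + 2 * b * ∑ i, r i * ⟪lazyAverage b W x i - weightedMean r x, e i⟫ := by
  set m := weightedMean r x with hm
  set p : ι → E := fun i => lazyAverage b W x i - m with hp
  have hD := edgeEnergy_nonneg hr hW x
  have hmix : ∑ i, r i * ‖p i‖ ^ 2 ≤ dispersion r x - b * (1 - b) * edgeEnergy r W x :=
    sum_lazyAverage_le hr hW hrow hWr b x m
  have hcoef : b / 2 * edgeEnergy r W x ≤ b * (1 - b) * edgeEnergy r W x := by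
    refine mul_le_mul_of_nonneg_right ?_ hD
    nlinarith
  have hi : ∀ i, ‖x' i - m‖ ^ 2 ≤ ‖p i‖ ^ 2 + ε * b * ‖p i‖ ^ 2 + L ^ 2 / ε * (a ^ 2 / b)
      + 2 * b ^ 2 * ‖e i‖ ^ 2 + 2 * L ^ 2 * a ^ 2 + 2 * b * ⟪p i, e i⟫ := by
    intro i
    have h1 : x' i - m = p i + (b • e i - a • g i) := by
      simp only [hx' i, hp]
      abel
    have h2 := norm_smul_sub_smul_sq_le (a := a) (b := b) (e i) (g i) (hg i)
    have h3 : -⟪p i, g i⟫ ≤ L * ‖p i‖ := by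
      have h4 := neg_le_of_abs_le (abs_real_inner_le_norm (p i) (g i))
      nlinarith [mul_le_mul_of_nonneg_left (hg i) (norm_nonneg (p i))]
    have h5 := two_mul_le_mul_sq_add (mul_pos hε hb) (a * L) ‖p i‖
    have h6 : (a * L) ^ 2 / (ε * b) = L ^ 2 / ε * (a ^ 2 / b) := by
      field_simp
    rw [h1, norm_add_sq_real, inner_sub_right, real_inner_smul_right, real_inner_smul_right]
    nlinarith [mul_le_mul_of_nonneg_left h3 ha]
  have hsum : ∑ i, r i * ‖x' i - m‖ ^ 2 ≤ (1 + ε * b) * ∑ i, r i * ‖p i‖ ^ 2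
      + L ^ 2 / ε * (a ^ 2 / b) + 2 * b ^ 2 * ∑ i, r i * ‖e i‖ ^ 2 + 2 * L ^ 2 * a ^ 2
      + 2 * b * ∑ i, r i * ⟪p i, e i⟫ := by
    refine (Finset.sum_le_sum fun i _ => mul_le_mul_of_nonneg_left (hi i) (hr i)).trans_eq ?_
    have hc : ∀ c : ℝ, c = ∑ i, r i * c := fun c => by rw [← Finset.sum_mul, hs, one_mul]
    rw [hc (L ^ 2 / ε * (a ^ 2 / b)), hc (2 * L ^ 2 * a ^ 2), Finset.mul_sum, Finset.mul_sum,
      Finset.mul_sum]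
    simp only [← Finset.sum_add_distrib]
    refine Finset.sum_congr rfl fun i _ => ?_
    simp only [← Finset.sum_mul, hs]
    ring
  have hle : ∑ i, r i * ‖p i‖ ^ 2 ≤ dispersion r x := by nlinarith [mul_nonneg hb.le hD]
  have hεb := mul_le_mul_of_nonneg_left hle (mul_pos hε hb).le
  linarith [dispersion_le_sum hs x' m]

theorem weightedMean_step (hWr : ∀ j, ∑ i, r i * W i j = r j)
    (hx' : ∀ i, x' i = lazyAverage b W x i + b • e i - a • g i) :
    weightedMean r x' = weightedMean r x + (b • weightedMean r e - a • weightedMean r g) := by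
  have h1 : weightedMean r x' = (1 - b) • weightedMean r x
      + b • weightedMean r (fun i => ∑ j, W i j • x j)
      + (b • weightedMean r e - a • weightedMean r g) := by
    simp only [weightedMean, Finset.smul_sum (s := Finset.univ) (r := b),
      Finset.smul_sum (s := Finset.univ) (r := a), Finset.smul_sum (s := Finset.univ) (r := 1 - b)]
    rw [← Finset.sum_add_distrib, ← Finset.sum_sub_distrib, ← Finset.sum_add_distrib]
    refine Finset.sum_congr rfl fun i _ => ?_
    rw [hx' i, lazyAverage]
    generalize ∑ j, W i j • x j = w
    module
  rw [h1, weightedMean_mulVec hWr, ← add_smul, sub_add_cancel, one_smul]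

/-- One-step estimate for the distance of the mean to a point `z`. -/
theorem norm_weightedMean_step_sub_sq_le (hr : ∀ i, 0 ≤ r i) (hs : ∑ i, r i = 1)
    (hWr : ∀ j, ∑ i, r i * W i j = r j) (ha : 0 ≤ a) (hb : 0 < b)
    (hg : ∀ i, ‖g i‖ ≤ L) (hx' : ∀ i, x' i = lazyAverage b W x i + b • e i - a • g i)
    {f : ι → E → ℝ} (hlip : ∀ i p y, f i p - L * ‖y - p‖ ≤ f i y)
    (hsub : ∀ i y, f i (x i) + ⟪g i, y - x i⟫ ≤ f i y) (z : E) :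
    ‖weightedMean r x' - z‖ ^ 2 ≤ ‖weightedMean r x - z‖ ^ 2
      - 2 * a * (∑ i, r i * f i (weightedMean r x) - ∑ i, r i * f i z)
      + (b * dispersion r x + 4 * L ^ 2 * (a ^ 2 / b)
        + 2 * b ^ 2 * ∑ i, r i * ‖e i‖ ^ 2 + 2 * L ^ 2 * a ^ 2)
      + 2 * b * ⟪weightedMean r x - z, weightedMean r e⟫ := by
  set m := weightedMean r x with hm
  have hgm : ‖weightedMean r g‖ ≤ L := by
    refine (norm_sum_le _ _).trans ?_
    calc ∑ i, ‖r i • g i‖ ≤ ∑ i, r i * L := Finset.sum_le_sum fun i _ => by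
          rw [norm_smul, Real.norm_of_nonneg (hr i)]
          exact mul_le_mul_of_nonneg_left (hg i) (hr i)
      _ = L := by rw [← Finset.sum_mul, hs, one_mul]
  have h1 := norm_smul_sub_smul_sq_le (a := a) (b := b) (weightedMean r e) _ hgm
  have h2 : ‖weightedMean r e‖ ^ 2 ≤ ∑ i, r i * ‖e i‖ ^ 2 := norm_sum_smul_sq_le hr hs e
  have h3 := mul_le_mul_of_nonneg_left h2 (mul_nonneg zero_le_two (sq_nonneg b))
  have hi : ∀ i, 2 * a * (f i m - f i z) - (b * ‖x i - m‖ ^ 2 + 4 * L ^ 2 * (a ^ 2 / b))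
      ≤ 2 * a * ⟪m - z, g i⟫ := by
    intro i
    have h4 := neg_le_of_abs_le (abs_real_inner_le_norm (g i) (m - x i))
    have h5 := mul_le_mul_of_nonneg_right (hg i) (norm_nonneg (m - x i))
    have h6 : ⟪m - z, g i⟫ = ⟪g i, m - x i⟫ - ⟪g i, z - x i⟫ := by
      rw [← inner_sub_right, real_inner_comm, sub_sub_sub_cancel_right]
    have h7 := hlip i m (x i)
    have h8 := two_mul_le_mul_sq_add hb (2 * a * L) ‖x i - m‖
    have h9 : (2 * a * L) ^ 2 / b = 4 * L ^ 2 * (a ^ 2 / b) := by ring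
    rw [norm_sub_rev m (x i)] at h4 h5
    have h10 : f i m - f i z - 2 * (L * ‖x i - m‖) ≤ ⟪m - z, g i⟫ := by
      linarith [hsub i z]
    nlinarith [mul_le_mul_of_nonneg_left h10 ha]
  have hsum : 2 * a * (∑ i, r i * f i m - ∑ i, r i * f i z)
      - (b * dispersion r x + 4 * L ^ 2 * (a ^ 2 / b)) ≤ 2 * a * ⟪m - z, weightedMean r g⟫ := by
    have h := Finset.sum_le_sum fun i (_ : i ∈ Finset.univ) =>
      mul_le_mul_of_nonneg_left (hi i) (hr i)
    have hl : ∑ i, r i * (2 * a * (f i m - f i z)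
        - (b * ‖x i - m‖ ^ 2 + 4 * L ^ 2 * (a ^ 2 / b)))
        = 2 * a * (∑ i, r i * f i m - ∑ i, r i * f i z)
          - (b * dispersion r x + 4 * L ^ 2 * (a ^ 2 / b)) := by
      have hc : ∀ c : ℝ, c = ∑ i, r i * c := fun c => by rw [← Finset.sum_mul, hs, one_mul]
      rw [hc (4 * L ^ 2 * (a ^ 2 / b)), dispersion, ← Finset.sum_sub_distrib, Finset.mul_sum,
        Finset.mul_sum, ← Finset.sum_add_distrib, ← Finset.sum_sub_distrib]
      refine Finset.sum_congr rfl fun i _ => ?_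
      simp only [← Finset.sum_mul, hs]
      ring
    have hr' : ∑ i, r i * (2 * a * ⟪m - z, g i⟫) = 2 * a * ⟪m - z, weightedMean r g⟫ := by
      rw [weightedMean, inner_sum, Finset.mul_sum]
      exact Finset.sum_congr rfl fun i _ => by rw [real_inner_smul_right]; ring
    rwa [hl, hr'] at h
  have hx : weightedMean r x' - z = (m - z) + (b • weightedMean r e - a • weightedMean r g) := by
    rw [weightedMean_step hWr hx']; abel
  rw [hx, norm_add_sq_real, inner_sub_right, real_inner_smul_right, real_inner_smul_right]
  linarith

/-- The weighted squared displacement in one step. -/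
theorem sum_mul_norm_step_sub_sq_le (hr : ∀ i, 0 ≤ r i) (hs : ∑ i, r i = 1)
    (hW : ∀ i j, 0 ≤ W i j) (hrow : ∀ i, ∑ j, W i j = 1) (hb : 0 ≤ b) (hb' : b ≤ 1)
    (hg : ∀ i, ‖g i‖ ≤ L)
    (hx' : ∀ i, x' i = lazyAverage b W x i + b • e i - a • g i) :
    ∑ i, r i * ‖x' i - x i‖ ^ 2 ≤ 4 * edgeEnergy r W x
      + 4 * b ^ 2 * ∑ i, r i * ‖e i‖ ^ 2 + 2 * L ^ 2 * a ^ 2 := by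
  have hi : ∀ i, ‖x' i - x i‖ ^ 2 ≤ 4 * (∑ j, W i j * ‖x j - x i‖ ^ 2)
      + 4 * b ^ 2 * ‖e i‖ ^ 2 + 2 * L ^ 2 * a ^ 2 := by
    intro i
    have h1 : x' i - x i = b • ((∑ j, W i j • x j - x i) - -e i) - a • g i := by
      rw [hx' i, lazyAverage]; module
    have h2 := norm_smul_sub_smul_sq_le (a := a) (b := b)
      ((∑ j, W i j • x j - x i) - -e i) (g i) (hg i)
    have h3 := norm_sub_sq_le_two_mul (∑ j, W i j • x j - x i) (-e i)
    have h4 := norm_sum_smul_sub_sq_le (hW i) (hrow i) x (x i)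
    have h5 : b ^ 2 ≤ 1 := by nlinarith
    have h6 : 0 ≤ ∑ j, W i j * ‖x j - x i‖ ^ 2 := (sq_nonneg _).trans h4
    rw [norm_neg] at h3
    rw [h1]
    nlinarith [mul_le_mul_of_nonneg_left h3 (sq_nonneg b),
      mul_le_mul_of_nonneg_left h4 (sq_nonneg b), mul_le_mul_of_nonneg_right h5 h6]
  refine (Finset.sum_le_sum fun i _ => mul_le_mul_of_nonneg_left (hi i) (hr i)).trans_eq ?_
  have hc : ∀ c : ℝ, c = ∑ i, r i * c := fun c => by rw [← Finset.sum_mul, hs, one_mul]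
  rw [hc (2 * L ^ 2 * a ^ 2), edgeEnergy, Finset.mul_sum, Finset.mul_sum,
    ← Finset.sum_add_distrib, ← Finset.sum_add_distrib]
  refine Finset.sum_congr rfl fun i _ => ?_
  simp only [← Finset.sum_mul, hs]
  ring

end PerturbedStep

section Window

variable {ι E : Type*} [Fintype ι] [NormedAddCommGroup E]

/-- On a finite index set, distances between connected points are controlled by the edge lengths,
uniformly over all relations. -/
theorem exists_norm_sub_le_of_reflTransGen (ι E : Type*) [Finite ι] [NormedAddCommGroup E] :
    ∃ M : ℕ, ∀ (R : ι → ι → Prop) (u v : ι), Relation.ReflTransGen R u v →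
      ∀ (y : ι → E) (q : ℝ), 0 ≤ q → (∀ u v, R u v → ‖y u - y v‖ ≤ q) →
        ‖y u - y v‖ ≤ M * q := by
  have hpath : ∀ p : (ι → ι → Prop) × ι × ι, ∃ M : ℕ, Relation.ReflTransGen p.1 p.2.1 p.2.2 →
      ∀ (y : ι → E) (q : ℝ), 0 ≤ q → (∀ u v, p.1 u v → ‖y u - y v‖ ≤ q) →
        ‖y p.2.1 - y p.2.2‖ ≤ M * q := by
    rintro ⟨R, u, v⟩
    by_cases h : Relation.ReflTransGen R u v
    · induction h with
      | refl => exact ⟨0, fun _ y q _ _ => by simp⟩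
      | @tail v w huv hvw ih =>
        obtain ⟨M, hM⟩ := ih
        refine ⟨M + 1, fun _ y q hq hR => ?_⟩
        have h1 : ‖y u - y v‖ ≤ M * q := hM huv y q hq hR
        have h2 := norm_sub_le_norm_sub_add_norm_sub (y u) (y v) (y w)
        push_cast
        linarith [hR v w hvw]
    · exact ⟨0, fun h' => absurd h' h⟩
  choose m hm using hpath
  obtain ⟨M, hM⟩ := Finite.exists_le m
  refine ⟨M, fun R u v h y q hq hR => (hm (R, u, v) h y q hq hR).trans ?_⟩
  exact mul_le_mul_of_nonneg_right (by exact_mod_cast hM (R, u, v)) hq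

variable [InnerProductSpace ℝ E]

/-- Over a window in which the union of the communication graphs is strongly connected, the final
dispersion is controlled by the edge energies and the displacements in the window. -/
theorem exists_dispersion_le_window [Nonempty ι] {r : ι → ℝ} (hr : ∀ i, 0 < r i)
    (hs : ∑ i, r i = 1) {η : ℝ} (hη : 0 < η) (B : ℕ) (W : ℕ → Matrix ι ι ℝ)
    (hW : ∀ t i j, 0 ≤ W t i j) (hWη : ∀ t i j, W t i j ≠ 0 → η ≤ W t i j)
    (hconn : ∀ (t : ℕ) (u v : ι), Relation.ReflTransGen
      (fun u v => ∃ k, t + 1 ≤ k ∧ k ≤ t + B ∧ 0 < W k v u) u v) :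
    ∃ C : ℝ, 0 < C ∧ ∀ (y : ℕ → ι → E) (t : ℕ), dispersion r (y (t + B + 1))
      ≤ C * ∑ k ∈ Finset.range (B + 1), (edgeEnergy r (W (t + k)) (y (t + k))
        + ∑ i, r i * ‖y (t + k + 1) i - y (t + k) i‖ ^ 2) := by
  obtain ⟨M, hM⟩ := exists_norm_sub_le_of_reflTransGen ι E
  obtain ⟨i₀, hi₀⟩ := Finite.exists_min r
  set ρ := r i₀ with hρ_def
  have hρ : 0 < ρ := hr i₀
  have hr0 : ∀ i, 0 ≤ r i := fun i => (hr i).le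
  set κ : ℝ := √(1 / (ρ * η)) + 2 * ((B + 1) * √(1 / ρ)) with hκ
  have hκ0 : 0 ≤ κ := by positivity
  refine ⟨(M * κ) ^ 2 + 1, by positivity, fun y t => ?_⟩
  set T := ∑ k ∈ Finset.range (B + 1), (edgeEnergy r (W (t + k)) (y (t + k))
        + ∑ i, r i * ‖y (t + k + 1) i - y (t + k) i‖ ^ 2) with hT
  have hD : ∀ k, 0 ≤ edgeEnergy r (W k) (y k) := fun k => edgeEnergy_nonneg hr0 (hW k) _
  have hQ : ∀ k, 0 ≤ ∑ i, r i * ‖y (k + 1) i - y k i‖ ^ 2 := fun k =>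
    Finset.sum_nonneg fun i _ => mul_nonneg (hr0 i) (sq_nonneg _)
  have hT0 : 0 ≤ T := Finset.sum_nonneg fun k _ => add_nonneg (hD _) (hQ _)
  have hterm : ∀ k ∈ Finset.range (B + 1), edgeEnergy r (W (t + k)) (y (t + k))
        + ∑ i, r i * ‖y (t + k + 1) i - y (t + k) i‖ ^ 2 ≤ T := fun k hk =>
    Finset.single_le_sum (f := fun k => edgeEnergy r (W (t + k)) (y (t + k))
        + ∑ i, r i * ‖y (t + k + 1) i - y (t + k) i‖ ^ 2)
      (fun k _ => add_nonneg (hD _) (hQ _)) hk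
  have hroot : ∀ {c s : ℝ}, 0 < c → 0 ≤ s → c * s ^ 2 ≤ T → s ≤ √(1 / c) * √T := by
    intro c s hc hs' h
    rw [← Real.sqrt_mul (by positivity), Real.le_sqrt hs' (by positivity), one_div_mul_eq_div,
      le_div_iff₀ hc]
    linarith
  have hjump : ∀ k ∈ Finset.range (B + 1), ∀ i,
      ‖y (t + k + 1) i - y (t + k) i‖ ≤ √(1 / ρ) * √T := by
    intro k hk i
    refine hroot hρ (norm_nonneg _) ?_
    have h1 : r i * ‖y (t + k + 1) i - y (t + k) i‖ ^ 2
        ≤ ∑ i, r i * ‖y (t + k + 1) i - y (t + k) i‖ ^ 2 :=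
      Finset.single_le_sum (f := fun i => r i * ‖y (t + k + 1) i - y (t + k) i‖ ^ 2)
        (fun i _ => mul_nonneg (hr0 i) (sq_nonneg _)) (Finset.mem_univ i)
    have h2 := mul_le_mul_of_nonneg_right (hi₀ i) (sq_nonneg ‖y (t + k + 1) i - y (t + k) i‖)
    linarith [hterm k hk, hD (t + k)]
  have hdrift : ∀ k ≤ B + 1, ∀ i,
      ‖y (t + B + 1) i - y (t + k) i‖ ≤ (B + 1) * (√(1 / ρ) * √T) := by
    intro k hk i
    have h1 : ‖y (t + B + 1) i - y (t + k) i‖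
        ≤ ∑ l ∈ Finset.Ico k (B + 1), ‖y (t + l + 1) i - y (t + l) i‖ := by
      have h := Finset.sum_Ico_sub (fun l => y (t + l) i) hk
      rw [show t + B + 1 = t + (B + 1) by ring, ← h]
      exact norm_sum_le _ _
    refine h1.trans ((Finset.sum_le_card_nsmul _ _ (√(1 / ρ) * √T) fun l hl =>
      hjump l (Finset.mem_range.2 (Finset.mem_Ico.1 hl).2) i).trans ?_)
    rw [nsmul_eq_mul]
    refine mul_le_mul_of_nonneg_right ?_ (by positivity)
    rw [Nat.card_Ico]
    exact_mod_cast Nat.sub_le _ _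
  have hedge : ∀ u v, (∃ k, t + 1 ≤ k ∧ k ≤ t + B ∧ 0 < W k v u) →
      ‖y (t + B + 1) u - y (t + B + 1) v‖ ≤ κ * √T := by
    rintro u v ⟨k', hk1, hk2, hpos⟩
    obtain ⟨k, rfl⟩ : ∃ k, k' = t + k := ⟨k' - t, by omega⟩
    have hk : k ∈ Finset.range (B + 1) := Finset.mem_range.2 (by omega)
    have h1 : ‖y (t + k) u - y (t + k) v‖ ≤ √(1 / (ρ * η)) * √T := by
      refine hroot (mul_pos hρ hη) (norm_nonneg _) ?_
      have h2 : W (t + k) v u * ‖y (t + k) u - y (t + k) v‖ ^ 2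
          ≤ ∑ j, W (t + k) v j * ‖y (t + k) j - y (t + k) v‖ ^ 2 :=
        Finset.single_le_sum (f := fun j => W (t + k) v j * ‖y (t + k) j - y (t + k) v‖ ^ 2)
          (fun j _ => mul_nonneg (hW _ _ _) (sq_nonneg _)) (Finset.mem_univ u)
      have h3 : r v * ∑ j, W (t + k) v j * ‖y (t + k) j - y (t + k) v‖ ^ 2
          ≤ edgeEnergy r (W (t + k)) (y (t + k)) :=
        Finset.single_le_sum
          (f := fun i => r i * ∑ j, W (t + k) i j * ‖y (t + k) j - y (t + k) i‖ ^ 2)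
          (fun i _ => mul_nonneg (hr0 i) <| Finset.sum_nonneg fun j _ =>
            mul_nonneg (hW _ _ _) (sq_nonneg _)) (Finset.mem_univ v)
      have h4 := mul_le_mul_of_nonneg_right (hWη (t + k) v u hpos.ne')
        (sq_nonneg ‖y (t + k) u - y (t + k) v‖)
      have h5 := mul_le_mul (hi₀ v) (h4.trans h2) (by positivity) (hr0 v)
      linarith [hterm k hk, hQ (t + k)]
    have h2 := hdrift k (by omega) u
    have h3 := hdrift k (by omega) v
    have h4 : y (t + B + 1) u - y (t + B + 1) v = (y (t + B + 1) u - y (t + k) u)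
        + (y (t + k) u - y (t + k) v) - (y (t + B + 1) v - y (t + k) v) := by abel
    have h5 := norm_sub_le ((y (t + B + 1) u - y (t + k) u) + (y (t + k) u - y (t + k) v))
      (y (t + B + 1) v - y (t + k) v)
    have h6 := norm_add_le (y (t + B + 1) u - y (t + k) u) (y (t + k) u - y (t + k) v)
    rw [h4, hκ]
    linarith
  calc dispersion r (y (t + B + 1))
      ≤ ∑ i, r i * ‖y (t + B + 1) i - y (t + B + 1) i₀‖ ^ 2 := dispersion_le_sum hs _ _
    _ ≤ ∑ i, r i * (M * (κ * √T)) ^ 2 := Finset.sum_le_sum fun i _ =>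
        mul_le_mul_of_nonneg_left (pow_le_pow_left₀ (norm_nonneg _)
          (hM _ i i₀ (hconn t i i₀) _ _ (by positivity) hedge) 2) (hr0 i)
    _ = (M * κ) ^ 2 * T := by
        rw [← Finset.sum_mul, hs, ← mul_assoc, mul_pow, Real.sq_sqrt hT0]
        ring
    _ ≤ _ := mul_le_mul_of_nonneg_right (by linarith) hT0

end Window

section Sequences

open Finset in
/-- A nonnegative sequence that decreases up to convergent perturbations converges, and the
decrements are summable. -/
theorem summable_and_tendsto_of_le_sub_add {a b c ξ : ℕ → ℝ} (ha : ∀ t, 0 ≤ a t)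
    (hb : ∀ t, 0 ≤ b t) (hc : Summable c)
    (hξ : ∃ l, Tendsto (fun t => ∑ s ∈ range t, ξ s) atTop (nhds l))
    (h : ∀ t, a (t + 1) ≤ a t - b t + c t + ξ t) :
    Summable b ∧ ∃ l, Tendsto a atTop (nhds l) := by
  obtain ⟨l, hl⟩ := hξ
  set P : ℕ → ℝ := fun t => ∑ s ∈ range t, c s + ∑ s ∈ range t, ξ s with hP
  have hPlim : Tendsto P atTop (nhds (∑' t, c t + l)) := hc.hasSum.tendsto_sum_nat.add hl
  obtain ⟨K, hK⟩ := hPlim.bddAbove_range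
  have hPK : ∀ t, P t ≤ K := fun t => hK ⟨t, rfl⟩
  set u : ℕ → ℝ := fun t => a t + ∑ s ∈ range t, b s - P t with hu
  have hanti : Antitone u := antitone_nat_of_succ_le fun t => by
    simp only [hu, hP, sum_range_succ]
    linarith [h t]
  have hbsum : Summable b := by
    refine summable_of_sum_range_le (c := u 0 + K) hb fun t => ?_
    have h1 : u t ≤ u 0 := hanti (Nat.zero_le t)
    have h2 : u t = a t + ∑ s ∈ range t, b s - P t := rfl
    linarith [ha t, hPK t]
  refine ⟨hbsum, ?_⟩
  have hbdd : BddBelow (Set.range u) := by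
    refine ⟨-K, ?_⟩
    rintro _ ⟨t, rfl⟩
    have h2 : u t = a t + ∑ s ∈ range t, b s - P t := rfl
    linarith [ha t, hPK t, sum_nonneg fun s (_ : s ∈ range t) => hb s]
  have hlim := ((tendsto_atTop_ciInf hanti hbdd).sub hbsum.hasSum.tendsto_sum_nat).add hPlim
  refine ⟨_, hlim.congr fun t => ?_⟩
  simp only [hu]
  ring

open Finset in
/-- Summability of the weighted energies `w` from a descent inequality with dissipation `h` and a
windowed lower bound on the dissipation. -/
theorem summable_of_descent_of_window {v w h s s' : ℕ → ℝ} {ε C : ℝ} {B : ℕ}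
    (hv : ∀ t, 0 ≤ v t) (hw : ∀ t, 0 ≤ w t) (hh : ∀ t, 0 ≤ h t) (hs : ∀ t, 0 ≤ s t)
    (hs' : ∀ t, 0 ≤ s' t) (hssum : Summable s) (hs'sum : Summable s') (hC : 0 ≤ C)
    (hεC : 4 * ε * C * (B + 1) ≤ 1)
    (hdesc : ∀ t, v (t + 1) ≤ v t - h t / 2 + ε * w t + s t)
    (hwin : ∀ t, w (t + B + 1) ≤ C * ∑ k ∈ range (B + 1), (h (t + k) + s' (t + k))) :
    Summable w := by
  have hS : ∀ T, ∑ t ∈ range T, s t ≤ ∑' t, s t := fun T => hssum.sum_le_tsum _ fun t _ => hs t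
  have hS' : ∀ T, ∑ t ∈ range T, s' t ≤ ∑' t, s' t := fun T =>
    hs'sum.sum_le_tsum _ fun t _ => hs' t
  have hhsum : ∀ T, ∑ t ∈ range T, h t
      ≤ 2 * v 0 + 2 * ε * ∑ t ∈ range T, w t + 2 * ∑' t, s t := by
    intro T
    have : v T + (∑ t ∈ range T, h t) / 2
        ≤ v 0 + ε * ∑ t ∈ range T, w t + ∑ t ∈ range T, s t := by
      induction T with
      | zero => simp
      | succ T ih =>
        simp only [sum_range_succ]
        linarith [hdesc T]
    linarith [hv T, hS T]
  set K := ∑ t ∈ range (B + 1), w t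
    + C * (B + 1) * (2 * v 0 + 2 * ∑' t, s t + ∑' t, s' t) with hK
  have hmain : ∀ T, ∑ t ∈ range (B + 1 + T), w t ≤ 2 * K := by
    intro T
    have hshift : ∀ k ∈ range (B + 1), ∑ t ∈ range T, (h (t + k) + s' (t + k))
        ≤ ∑ t ∈ range (B + 1 + T), (h t + s' t) := by
      intro k hk
      have h1 := sum_range_add (fun t => h t + s' t) k T
      have h2 : 0 ≤ ∑ t ∈ range k, (h t + s' t) := sum_nonneg fun t _ => add_nonneg (hh t) (hs' t)
      have h3 : ∑ t ∈ range (k + T), (h t + s' t) ≤ ∑ t ∈ range (B + 1 + T), (h t + s' t) :=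
        sum_le_sum_of_subset_of_nonneg
          (range_subset_range.2 (by have := mem_range.1 hk; omega))
          fun t _ _ => add_nonneg (hh t) (hs' t)
      simp only [add_comm k] at h1 h3
      linarith
    have h1 : ∑ t ∈ range T, w (B + 1 + t)
        ≤ C * ((B + 1) * ∑ t ∈ range (B + 1 + T), (h t + s' t)) := by
      calc ∑ t ∈ range T, w (B + 1 + t)
          ≤ ∑ t ∈ range T, C * ∑ k ∈ range (B + 1), (h (t + k) + s' (t + k)) :=
            sum_le_sum fun t _ => by
              rw [show B + 1 + t = t + B + 1 by ring]
              exact hwin t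
        _ = C * ∑ k ∈ range (B + 1), ∑ t ∈ range T, (h (t + k) + s' (t + k)) := by
            rw [← mul_sum, sum_comm]
        _ ≤ _ := by
            refine mul_le_mul_of_nonneg_left ((sum_le_card_nsmul _ _ _ hshift).trans_eq ?_) hC
            rw [nsmul_eq_mul, card_range]
            push_cast
            ring
    have h2 := sum_range_add w (B + 1) T
    have hw0 : 0 ≤ ∑ t ∈ range (B + 1 + T), w t := sum_nonneg fun t _ => hw t
    have h3 : ∑ t ∈ range (B + 1 + T), (h t + s' t)
        ≤ 2 * v 0 + 2 * ε * ∑ t ∈ range (B + 1 + T), w t + 2 * ∑' t, s t + ∑' t, s' t := by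
      rw [sum_add_distrib]
      linarith [hhsum (B + 1 + T), hS' (B + 1 + T)]
    have hCB : 0 ≤ C * (B + 1) := by positivity
    have h4 := mul_le_mul_of_nonneg_left h3 hCB
    have h5 := mul_le_mul_of_nonneg_right hεC hw0
    rw [hK]
    linarith
  refine summable_of_sum_range_le (c := 2 * K) hw fun T => le_trans ?_ (hmain T)
  exact sum_le_sum_of_subset_of_nonneg (range_subset_range.2 (by omega)) fun t _ _ => hw t

/-- If `∑ a t = ∞` and `∑ a t * u t < ∞` then `u` is frequently small. -/
theorem frequently_lt_of_summable_mul {a u : ℕ → ℝ} (ha : ∀ t, 0 ≤ a t) (ha' : ¬ Summable a)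
    (hau : Summable fun t => a t * u t) {ε : ℝ} (hε : 0 < ε) : ∃ᶠ t in atTop, u t < ε := by
  intro hev
  refine ha' (Summable.of_norm_bounded_eventually_nat (hau.mul_left ε⁻¹) ?_)
  filter_upwards [hev] with t ht
  rw [Real.norm_of_nonneg (ha t), inv_mul_eq_div, le_div_iff₀ hε]
  exact mul_le_mul_of_nonneg_left (not_lt.1 ht) (ha t)

theorem eq_zero_of_tendsto_of_summable_mul {a u : ℕ → ℝ} {l : ℝ} (ha : ∀ t, 0 ≤ a t)
    (ha' : ¬ Summable a) (hau : Summable fun t => a t * u t) (hu : ∀ t, 0 ≤ u t)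
    (hl : Tendsto u atTop (nhds l)) : l = 0 := by
  refine le_antisymm (le_of_forall_pos_le_add fun ε hε => ?_) (ge_of_tendsto' hl hu)
  rw [zero_add]
  exact le_of_tendsto_of_frequently hl
    ((frequently_lt_of_summable_mul ha ha' hau hε).mono fun t ht => ht.le)

/-- A Fejér-type convergence criterion: a sequence whose distance to each point of a dense set of
minimizers converges, and along which the objective is frequently almost minimal, converges to a
minimizer. -/
theorem exists_tendsto_minimizer {E : Type*} [NormedAddCommGroup E] [ProperSpace E] {Φ : E → ℝ}
    (hΦ : Continuous Φ) {S : Set E} {z₀ : E} (hz₀ : z₀ ∈ S) (hz₀' : ∀ y, Φ z₀ ≤ Φ y)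
    (hS : {z | ∀ y, Φ z ≤ Φ y} ⊆ closure S) {x : ℕ → E}
    (hdist : ∀ z ∈ S, ∃ l, Tendsto (fun t => ‖x t - z‖ ^ 2) atTop (nhds l))
    (hfreq : ∀ ε > 0, ∃ᶠ t in atTop, Φ (x t) - Φ z₀ < ε) :
    ∃ p, (∀ y, Φ p ≤ Φ y) ∧ Tendsto x atTop (nhds p) := by
  have hnorm : ∀ z ∈ S, ∃ l, Tendsto (fun t => ‖x t - z‖) atTop (nhds l) := by
    intro z hz
    obtain ⟨l, hl⟩ := hdist z hz
    refine ⟨√l, hl.sqrt.congr fun t => ?_⟩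
    rw [Real.sqrt_sq (norm_nonneg _)]
  have hbdd : Bornology.IsBounded (Set.range x) := by
    obtain ⟨l, hl⟩ := hnorm z₀ hz₀
    obtain ⟨K, hK⟩ := hl.bddAbove_range
    refine (Metric.isBounded_iff_subset_closedBall z₀).2 ⟨K, ?_⟩
    rintro _ ⟨t, rfl⟩
    rw [mem_closedBall_iff_norm]
    exact hK ⟨t, rfl⟩
  obtain ⟨φ, hφ, hφΦ⟩ := extraction_forall_of_frequently
    (P := fun n t => Φ (x t) - Φ z₀ < 1 / ((n : ℝ) + 1))
    fun n => hfreq _ Nat.one_div_pos_of_nat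
  obtain ⟨p, -, ψ, hψ, hp⟩ := tendsto_subseq_of_bounded (x := x ∘ φ) hbdd fun n => ⟨φ n, rfl⟩
  have hpmin : Φ p ≤ Φ z₀ := by
    have h1 : Tendsto (fun n => Φ (x (φ (ψ n))) - Φ z₀) atTop (nhds (Φ p - Φ z₀)) :=
      ((hΦ.tendsto p).comp hp).sub_const _
    have h2 : Tendsto (fun n => 1 / ((ψ n : ℝ) + 1)) atTop (nhds 0) :=
      tendsto_one_div_add_atTop_nhds_zero_nat.comp hψ.tendsto_atTop
    linarith [le_of_tendsto_of_tendsto' h1 h2 fun n => (hφΦ (ψ n)).le]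
  have hp' : ∀ y, Φ p ≤ Φ y := fun y => hpmin.trans (hz₀' y)
  refine ⟨p, hp', Metric.tendsto_atTop.2 fun ε hε => ?_⟩
  obtain ⟨z, hz, hpz⟩ := Metric.mem_closure_iff.1 (hS hp') (ε / 2) (half_pos hε)
  obtain ⟨l, hl⟩ := hnorm z hz
  have hl' : l = ‖p - z‖ := tendsto_nhds_unique
    (hl.comp (hφ.tendsto_atTop.comp hψ.tendsto_atTop)) (hp.sub_const z).norm
  rw [dist_eq_norm] at hpz
  obtain ⟨N, hN⟩ := eventually_atTop.1 (hl.eventually_lt_const (hl' ▸ hpz))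
  refine ⟨N, fun t ht => ?_⟩
  rw [dist_eq_norm]
  have := norm_sub_le_norm_sub_add_norm_sub (x t) z p
  rw [norm_sub_rev z p] at this
  linarith [hN t ht]

end Sequences

section AlmostSupermartingale

variable {Ω : Type*} {m0 : MeasurableSpace Ω} {μ : Measure Ω}

theorem ae_summable_of_summable_integral {c : ℕ → Ω → ℝ} (hc : ∀ t ω, 0 ≤ c t ω)
    (hintg : ∀ t, Integrable (c t) μ) (hsum : Summable fun t => ∫ ω, c t ω ∂μ) :
    ∀ᵐ ω ∂μ, Summable fun t => c t ω := by
  have hlin : ∫⁻ ω, ∑' t, ENNReal.ofReal (c t ω) ∂μ ≠ ⊤ := by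
    rw [lintegral_tsum fun t => (hintg t).aemeasurable.ennreal_ofReal]
    simp only [← ofReal_integral_eq_lintegral_ofReal (hintg _) (ae_of_all _ (hc _))]
    exact hsum.tsum_ofReal_ne_top
  filter_upwards [ae_lt_top' (AEMeasurable.tsum fun t =>
    (hintg t).aemeasurable.ennreal_ofReal) hlin] with ω hω
  refine (ENNReal.summable_toReal hω.ne).congr fun t => ?_
  rw [ENNReal.toReal_ofReal (hc t ω)]

open Finset in
/-- A Robbins–Siegmund type theorem: a nonnegative process that decreases up to a summable error
and a martingale difference converges almost surely, with summable decrements. -/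
theorem ae_summable_and_tendsto_of_le_sub_add [IsFiniteMeasure μ] {F : Filtration ℕ m0}
    {a b c ξ : ℕ → Ω → ℝ} (ha : ∀ t ω, 0 ≤ a t ω) (hb : ∀ t ω, 0 ≤ b t ω)
    (hc : ∀ t ω, 0 ≤ c t ω) (ha_int : Integrable (a 0) μ) (hc_int : ∀ t, Integrable (c t) μ)
    (hc_sum : Summable fun t => ∫ ω, c t ω ∂μ) (hξ_int : ∀ t, Integrable (ξ t) μ)
    (hξ_meas : ∀ t, StronglyMeasurable[F (t + 1)] (ξ t)) (hξ : ∀ t, μ[ξ t|F t] =ᵐ[μ] 0)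
    (h : ∀ t ω, a (t + 1) ω ≤ a t ω - b t ω + c t ω + ξ t ω) :
    ∀ᵐ ω ∂μ, (Summable fun t => b t ω) ∧ ∃ l, Tendsto (fun t => a t ω) atTop (nhds l) := by
  set M : ℕ → Ω → ℝ := fun t ω => ∑ s ∈ range t, ξ s ω with hM
  have hM_int : ∀ t, Integrable (M t) μ := fun t => integrable_finsetSum _ fun s _ => hξ_int s
  have hmart : Martingale M F μ := by
    refine martingale_of_condExp_sub_eq_zero_nat (fun t => ?_) hM_int fun t => ?_
    · refine Finset.stronglyMeasurable_fun_sum _ fun s hs => ?_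
      exact (hξ_meas s).mono (F.mono (mem_range.1 hs))
    · have : M (t + 1) - M t = ξ t := by
        ext ω
        simp [hM, sum_range_succ]
      rw [this]
      exact hξ t
  have hlow : ∀ t ω, 0 ≤ M t ω + (a 0 ω + ∑ s ∈ range t, c s ω) := by
    intro t ω
    have : a t ω ≤ M t ω + (a 0 ω + ∑ s ∈ range t, c s ω) := by
      induction t with
      | zero => simp [hM]
      | succ t ih =>
        simp only [hM, sum_range_succ] at ih ⊢
        linarith [h t ω, hb t ω]
    exact (ha t ω).trans this
  have hA_int : ∀ t, Integrable (fun ω => a 0 ω + ∑ s ∈ range t, c s ω) μ := fun t =>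
    ha_int.add (integrable_finsetSum _ fun s _ => hc_int s)
  have hmean : ∀ t, ∫ ω, M t ω ∂μ = 0 := by
    intro t
    simp only [hM]
    rw [integral_finsetSum _ fun s _ => hξ_int s]
    refine sum_eq_zero fun s _ => ?_
    rw [← integral_condExp (F.le s), integral_congr_ae (hξ s)]
    simp
  set R : ℝ := 2 * (∫ ω, a 0 ω ∂μ + ∑' t, ∫ ω, c t ω ∂μ) with hR
  have hbound : ∀ t, eLpNorm (M t) 1 μ ≤ (R.toNNReal : ENNReal) := by
    intro t
    rw [eLpNorm_one_eq_lintegral_enorm, ← ofReal_integral_norm_eq_lintegral_enorm (hM_int t)]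
    refine ENNReal.ofReal_le_ofReal ?_
    calc ∫ ω, ‖M t ω‖ ∂μ
        ≤ ∫ ω, (M t ω + 2 * (a 0 ω + ∑ s ∈ range t, c s ω)) ∂μ := by
          refine integral_mono (hM_int t).norm ((hM_int t).add ((hA_int t).const_mul 2))
            fun ω => ?_
          have h1 : 0 ≤ a 0 ω + ∑ s ∈ range t, c s ω :=
            add_nonneg (ha 0 ω) (sum_nonneg fun s _ => hc s ω)
          have h2 := hlow t ω
          exact abs_le.2 ⟨by linarith, by linarith⟩
      _ = 2 * (∫ ω, a 0 ω ∂μ + ∑ s ∈ range t, ∫ ω, c s ω ∂μ) := by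
          rw [integral_add (hM_int t) ((hA_int t).const_mul 2), hmean, integral_const_mul,
            integral_add ha_int (integrable_finsetSum _ fun s _ => hc_int s),
            integral_finsetSum _ fun s _ => hc_int s, zero_add]
      _ ≤ R := by
          have := hc_sum.sum_le_tsum (range t) fun s _ => integral_nonneg (hc s)
          rw [hR]
          linarith
  filter_upwards [hmart.submartingale.exists_ae_tendsto_of_bdd hbound,
    ae_summable_of_summable_integral hc hc_int hc_sum] with ω hω hcω
  exact summable_and_tendsto_of_le_sub_add (fun t => ha t ω) (fun t => hb t ω) hcω hω
    fun t => h t ω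

end AlmostSupermartingale

section NoisyConsensus

variable {Ω : Type*} {m0 : MeasurableSpace Ω} {μ : Measure Ω} {ι E : Type*} [Fintype ι]
  [NormedAddCommGroup E] [InnerProductSpace ℝ E]

theorem MeasureTheory.MemLp.integrable_norm_sq {E : Type*} [NormedAddCommGroup E]
    {y : Ω → E} (hy : MemLp y 2 μ) :
    Integrable (fun ω => ‖y ω‖ ^ 2) μ :=
  (memLp_two_iff_integrable_sq_norm hy.1).1 hy

theorem MeasureTheory.MemLp.integrable_real_inner {y e : Ω → E} (hy : MemLp y 2 μ)
    (he : MemLp e 2 μ) : Integrable (fun ω => ⟪y ω, e ω⟫) μ := by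
  refine (hy.integrable_norm_sq.add he.integrable_norm_sq).mono' (hy.1.inner he.1)
    (ae_of_all _ fun ω => ?_)
  refine (abs_real_inner_le_norm _ _).trans ?_
  simp only [Pi.add_apply]
  nlinarith [sq_nonneg (‖y ω‖ - ‖e ω‖), sq_nonneg (‖y ω‖ + ‖e ω‖)]

theorem condExp_real_inner_eq_zero [CompleteSpace E] [IsFiniteMeasure μ] {m : MeasurableSpace Ω}
    {y e : Ω → E} (hy_meas : StronglyMeasurable[m] y) (hy : MemLp y 2 μ) (he : MemLp e 2 μ)
    (hmean : μ[e|m] =ᵐ[μ] 0) : μ[fun ω => ⟪y ω, e ω⟫|m] =ᵐ[μ] 0 := by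
  filter_upwards [condExp_bilin_of_stronglyMeasurable_left (innerSL ℝ) hy_meas
    (hy.integrable_real_inner he) (he.integrable one_le_two), hmean] with ω h1 h2
  have h3 : (μ[fun ω => ⟪y ω, e ω⟫|m]) ω = ⟪y ω, (μ[e|m]) ω⟫ := h1
  rw [h3, h2]
  simp

theorem memLp_lazyAverage {b : ℝ} {W : Matrix ι ι ℝ} {x : Ω → ι → E}
    (hx : ∀ i, MemLp (fun ω => x ω i) 2 μ) (i : ι) :
    MemLp (fun ω => lazyAverage b W (x ω) i) 2 μ :=
  ((hx i).const_smul (1 - b)).add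
    ((memLp_finsetSum _ fun j _ => (hx j).const_smul (W i j)).const_smul b)

theorem memLp_weightedMean {r : ι → ℝ} {x : Ω → ι → E} (hx : ∀ i, MemLp (fun ω => x ω i) 2 μ) :
    MemLp (fun ω => weightedMean r (x ω)) 2 μ :=
  memLp_finsetSum _ fun i _ => (hx i).const_smul (r i)

theorem stronglyMeasurable_lazyAverage {m : MeasurableSpace Ω} {b : ℝ} {W : Matrix ι ι ℝ}
    {x : Ω → ι → E} (hx : ∀ i, StronglyMeasurable[m] fun ω => x ω i) (i : ι) :
    StronglyMeasurable[m] fun ω => lazyAverage b W (x ω) i :=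
  ((hx i).const_smul (1 - b)).add
    ((Finset.stronglyMeasurable_fun_sum _ fun j _ => (hx j).const_smul (W i j)).const_smul b)

theorem stronglyMeasurable_weightedMean {m : MeasurableSpace Ω} {r : ι → ℝ} {x : Ω → ι → E}
    (hx : ∀ i, StronglyMeasurable[m] fun ω => x ω i) :
    StronglyMeasurable[m] fun ω => weightedMean r (x ω) :=
  Finset.stronglyMeasurable_fun_sum _ fun i _ => (hx i).const_smul (r i)

theorem integrable_dispersion {r : ι → ℝ} {x : Ω → ι → E}
    (hx : ∀ i, MemLp (fun ω => x ω i) 2 μ) : Integrable (fun ω => dispersion r (x ω)) μ :=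
  integrable_finsetSum _ fun i _ =>
    ((hx i).sub (memLp_weightedMean hx)).integrable_norm_sq.const_mul (r i)

theorem integrable_edgeEnergy {E : Type*} [NormedAddCommGroup E]
    {r : ι → ℝ} {W : Matrix ι ι ℝ} {x : Ω → ι → E}
    (hx : ∀ i, MemLp (fun ω => x ω i) 2 μ) : Integrable (fun ω => edgeEnergy r W (x ω)) μ :=
  integrable_finsetSum _ fun i _ => (integrable_finsetSum _ fun j _ =>
    ((hx j).sub (hx i)).integrable_norm_sq.const_mul (W i j)).const_mul (r i)

/-- Square-integrable lazy averaging dynamics driven by martingale difference noise `e` and a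
bounded drift `g`. -/
structure NoisyConsensus (μ : Measure Ω) (F : Filtration ℕ m0) (r : ι → ℝ)
    (W : ℕ → Matrix ι ι ℝ) (α β : ℕ → ℝ) (L γ : ℝ) (x e g : ℕ → Ω → ι → E) : Prop where
  r_pos : ∀ i, 0 < r i
  r_sum : ∑ i, r i = 1
  W_nonneg : ∀ t i j, 0 ≤ W t i j
  W_row : ∀ t i, ∑ j, W t i j = 1
  W_r : ∀ t j, ∑ i, r i * W t i j = r j
  α_nonneg : ∀ t, 0 ≤ α t
  β_pos : ∀ t, 0 < β t
  β_le : ∀ t, β t ≤ 1 / 2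
  γ_nonneg : 0 ≤ γ
  g_le : ∀ t ω i, ‖g t ω i‖ ≤ L
  x_meas : ∀ t i, StronglyMeasurable[F t] fun ω => x t ω i
  g_meas : ∀ t i, StronglyMeasurable[F t] fun ω => g t ω i
  x_zero_memLp : ∀ i, MemLp (fun ω => x 0 ω i) 2 μ
  e_memLp : ∀ t i, MemLp (fun ω => e t ω i) 2 μ
  e_mean : ∀ t i, μ[fun ω => e t ω i|F t] =ᵐ[μ] 0
  e_var : ∀ t i, ∫ ω, ‖e t ω i‖ ^ 2 ∂μ ≤ γ
  dyn : ∀ t ω i, x (t + 1) ω i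
    = lazyAverage (β t) (W t) (x t ω) i + β t • e t ω i - α t • g t ω i

namespace NoisyConsensus

variable {F : Filtration ℕ m0} {r : ι → ℝ}
  {W : ℕ → Matrix ι ι ℝ} {α β : ℕ → ℝ} {L γ : ℝ} {x e g : ℕ → Ω → ι → E}

theorem memLp [IsFiniteMeasure μ] (h : NoisyConsensus μ F r W α β L γ x e g) (t : ℕ) (i : ι) :
    MemLp (fun ω => x t ω i) 2 μ := by
  induction t generalizing i with
  | zero => exact h.x_zero_memLp i
  | succ t ih =>
    have hg : MemLp (fun ω => g t ω i) 2 μ :=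
      MemLp.of_bound ((h.g_meas t i).mono (F.le t)).aestronglyMeasurable L
        (ae_of_all _ fun ω => h.g_le t ω i)
    simp only [h.dyn t]
    exact ((memLp_lazyAverage ih i).add ((h.e_memLp t i).const_smul (β t))).sub
      (hg.const_smul (α t))

theorem stronglyMeasurable_noise (h : NoisyConsensus μ F r W α β L γ x e g) (t : ℕ) (i : ι) :
    StronglyMeasurable[F (t + 1)] fun ω => e t ω i := by
  have he : (fun ω => e t ω i) = fun ω => (β t)⁻¹ •
      (x (t + 1) ω i - lazyAverage (β t) (W t) (x t ω) i + α t • g t ω i) := by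
    ext1 ω
    rw [h.dyn t, eq_inv_smul_iff₀ (h.β_pos t).ne']
    abel
  rw [he]
  have hmono : F t ≤ F (t + 1) := F.mono (Nat.le_succ t)
  exact (((h.x_meas (t + 1) i).sub
    ((stronglyMeasurable_lazyAverage (h.x_meas t) i).mono hmono)).add
      (((h.g_meas t i).mono hmono).const_smul (α t))).const_smul (β t)⁻¹

/-- Pairings of the noise with predictable vectors form a martingale difference sequence. -/
theorem noise_pairing [IsFiniteMeasure μ] [CompleteSpace E]
    (h : NoisyConsensus μ F r W α β L γ x e g) (t : ℕ)
    {y : ι → Ω → E} (hy_meas : ∀ i, StronglyMeasurable[F t] (y i)) (hy : ∀ i, MemLp (y i) 2 μ) :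
    Integrable (fun ω => 2 * β t * ∑ i, r i * ⟪y i ω, e t ω i⟫) μ ∧
    StronglyMeasurable[F (t + 1)] (fun ω => 2 * β t * ∑ i, r i * ⟪y i ω, e t ω i⟫) ∧
    μ[fun ω => 2 * β t * ∑ i, r i * ⟪y i ω, e t ω i⟫|F t] =ᵐ[μ] 0 := by
  have hintg : ∀ i, Integrable (fun ω => r i * ⟪y i ω, e t ω i⟫) μ := fun i =>
    ((hy i).integrable_real_inner (h.e_memLp t i)).const_mul (r i)
  refine ⟨(integrable_finsetSum _ fun i _ => hintg i).const_mul _, ?_, ?_⟩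
  · refine (Finset.stronglyMeasurable_fun_sum _ fun i _ => ?_).const_mul _
    exact (((hy_meas i).mono (F.mono (Nat.le_succ t))).inner
      (h.stronglyMeasurable_noise t i)).const_mul (r i)
  · have h1 : (fun ω => 2 * β t * ∑ i, r i * ⟪y i ω, e t ω i⟫)
        = (2 * β t) • ∑ i, r i • fun ω => ⟪y i ω, e t ω i⟫ := by
      ext ω
      simp
    have h2 : ∀ᵐ ω ∂μ, ∀ i, (μ[r i • fun ω => ⟪y i ω, e t ω i⟫|F t]) ω = 0 := by
      refine ae_all_iff.2 fun i => ?_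
      filter_upwards [condExp_smul (μ := μ) (r i) (fun ω => ⟪y i ω, e t ω i⟫) (F t),
        condExp_real_inner_eq_zero (hy_meas i) (hy i) (h.e_memLp t i) (h.e_mean t i)] with ω h3 h4
      rw [h3, Pi.smul_apply, h4]
      simp
    rw [h1]
    filter_upwards [condExp_smul (μ := μ) (2 * β t)
      (∑ i, r i • fun ω => ⟪y i ω, e t ω i⟫) (F t),
      condExp_finsetSum (μ := μ) (s := Finset.univ)
        (f := fun i => r i • fun ω => ⟪y i ω, e t ω i⟫) (fun i _ => hintg i) (F t), h2]
      with ω h3 h4 h5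
    rw [h3, Pi.smul_apply, h4, Finset.sum_apply]
    simp [h5]

theorem integrable_noise_energy (h : NoisyConsensus μ F r W α β L γ x e g) (t : ℕ) :
    Integrable (fun ω => ∑ i, r i * ‖e t ω i‖ ^ 2) μ :=
  integrable_finsetSum _ fun i _ => (h.e_memLp t i).integrable_norm_sq.const_mul (r i)

theorem integral_noise_energy_le (h : NoisyConsensus μ F r W α β L γ x e g) (t : ℕ) :
    ∫ ω, ∑ i, r i * ‖e t ω i‖ ^ 2 ∂μ ≤ γ := by
  rw [integral_finsetSum _ fun i _ => (h.e_memLp t i).integrable_norm_sq.const_mul (r i)]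
  calc ∑ i, ∫ ω, r i * ‖e t ω i‖ ^ 2 ∂μ ≤ ∑ i, r i * γ := Finset.sum_le_sum fun i _ => by
        rw [integral_const_mul]
        exact mul_le_mul_of_nonneg_left (h.e_var t i) (h.r_pos i).le
    _ = γ := by rw [← Finset.sum_mul, h.r_sum, one_mul]

theorem noise_energy_nonneg (h : NoisyConsensus μ F r W α β L γ x e g) (t : ℕ) (ω : Ω) :
    0 ≤ ∑ i, r i * ‖e t ω i‖ ^ 2 :=
  Finset.sum_nonneg fun i _ => mul_nonneg (h.r_pos i).le (sq_nonneg _)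

/-- The error term in the one-step estimates. -/
noncomputable def stepError (r : ι → ℝ) (α β : ℕ → ℝ) (x e : ℕ → Ω → ι → E)
    (p q s : ℝ) (t : ℕ) (ω : Ω) : ℝ :=
  p * (β t * dispersion r (x t ω)) + q * (α t ^ 2 / β t)
    + 2 * β t ^ 2 * ∑ i, r i * ‖e t ω i‖ ^ 2 + s * α t ^ 2

theorem stepError_nonneg (h : NoisyConsensus μ F r W α β L γ x e g) {p q s : ℝ} (hp : 0 ≤ p)
    (hq : 0 ≤ q) (hs : 0 ≤ s) (t : ℕ) (ω : Ω) : 0 ≤ stepError r α β x e p q s t ω := by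
  have h1 := dispersion_nonneg (fun i => (h.r_pos i).le) (x t ω)
  have h2 := h.noise_energy_nonneg t ω
  have h3 := h.β_pos t
  unfold stepError
  positivity

theorem integrable_stepError [IsFiniteMeasure μ]
    (h : NoisyConsensus μ F r W α β L γ x e g) (p q s : ℝ) (t : ℕ) :
    Integrable (stepError r α β x e p q s t) μ :=
  ((((integrable_dispersion (h.memLp t)).const_mul _).const_mul _).add (integrable_const _)).add
    ((h.integrable_noise_energy t).const_mul _) |>.add (integrable_const _)

theorem integral_stepError [IsFiniteMeasure μ]
    (h : NoisyConsensus μ F r W α β L γ x e g) (p q s : ℝ) (t : ℕ) :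
    ∫ ω, stepError r α β x e p q s t ω ∂μ ≤ p * (β t * ∫ ω, dispersion r (x t ω) ∂μ)
      + μ.real Set.univ * q * (α t ^ 2 / β t) + 2 * γ * β t ^ 2
      + μ.real Set.univ * s * α t ^ 2 := by
  have h1 : Integrable (fun ω => p * (β t * dispersion r (x t ω))) μ :=
    ((integrable_dispersion (h.memLp t)).const_mul _).const_mul _
  have h2 : Integrable (fun ω => 2 * β t ^ 2 * ∑ i, r i * ‖e t ω i‖ ^ 2) μ :=
    (h.integrable_noise_energy t).const_mul _
  have h3 := mul_le_mul_of_nonneg_left (h.integral_noise_energy_le t) (sq_nonneg (β t))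
  have h4 : ∫ ω, stepError r α β x e p q s t ω ∂μ
      = p * (β t * ∫ ω, dispersion r (x t ω) ∂μ) + μ.real Set.univ * (q * (α t ^ 2 / β t))
        + 2 * β t ^ 2 * ∫ ω, ∑ i, r i * ‖e t ω i‖ ^ 2 ∂μ
        + μ.real Set.univ * (s * α t ^ 2) := by
    have h12 : Integrable (fun ω => p * (β t * dispersion r (x t ω)) + q * (α t ^ 2 / β t)) μ :=
      h1.add (integrable_const _)
    have h123 : Integrable (fun ω => p * (β t * dispersion r (x t ω)) + q * (α t ^ 2 / β t)
        + 2 * β t ^ 2 * ∑ i, r i * ‖e t ω i‖ ^ 2) μ := h12.add h2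
    simp only [stepError]
    rw [integral_add h123 (integrable_const _), integral_add h12 h2,
      integral_add h1 (integrable_const _)]
    simp only [integral_const_mul, integral_const, smul_eq_mul]
    ring
  rw [h4]
  linarith

/-- The `β`-weighted mean dispersions are summable. -/
theorem summable_integral_dispersion [IsFiniteMeasure μ] [CompleteSpace E] [Nonempty ι]
    (h : NoisyConsensus μ F r W α β L γ x e g)
    {η : ℝ} (hη : 0 < η) {B : ℕ} (hWη : ∀ t i j, W t i j ≠ 0 → η ≤ W t i j)
    (hconn : ∀ (t : ℕ) (u v : ι), Relation.ReflTransGen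
      (fun u v => ∃ k, t + 1 ≤ k ∧ k ≤ t + B ∧ 0 < W k v u) u v)
    (hβ_mono : Antitone β) (hα_sq : Summable fun t => α t ^ 2)
    (hβ_sq : Summable fun t => β t ^ 2) (hαβ : Summable fun t => α t ^ 2 / β t) :
    Summable fun t => β t * ∫ ω, dispersion r (x t ω) ∂μ := by
  have hr : ∀ i, 0 ≤ r i := fun i => (h.r_pos i).le
  have hγ := h.γ_nonneg
  obtain ⟨C, hC, hwin⟩ := exists_dispersion_le_window (E := E) h.r_pos h.r_sum hη B W h.W_nonneg
    hWη hconn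
  set c := μ.real Set.univ with hc
  have hc0 : 0 ≤ c := measureReal_nonneg
  set ε : ℝ := 1 / (4 * (5 * C) * (B + 1)) with hε_def
  have hε : 0 < ε := by positivity
  have hdisp : ∀ t, Integrable (fun ω => dispersion r (x t ω)) μ := fun t =>
    integrable_dispersion (h.memLp t)
  have hedge : ∀ t, Integrable (fun ω => edgeEnergy r (W t) (x t ω)) μ := fun t =>
    integrable_edgeEnergy (h.memLp t)
  refine summable_of_descent_of_window (B := B) (C := 5 * C) (ε := ε)
    (v := fun t => ∫ ω, dispersion r (x t ω) ∂μ)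
    (h := fun t => β t * ∫ ω, edgeEnergy r (W t) (x t ω) ∂μ)
    (s := fun t => c * (L ^ 2 / ε) * (α t ^ 2 / β t) + 2 * γ * β t ^ 2
      + c * (2 * L ^ 2) * α t ^ 2)
    (s' := fun t => 4 * γ * β t ^ 2 + c * (2 * L ^ 2) * α t ^ 2)
    (fun t => integral_nonneg fun ω => dispersion_nonneg hr _)
    (fun t => mul_nonneg (h.β_pos t).le (integral_nonneg fun ω => dispersion_nonneg hr _))
    (fun t => mul_nonneg (h.β_pos t).le
      (integral_nonneg fun ω => edgeEnergy_nonneg hr (h.W_nonneg t) _))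
    (fun t => by have := h.β_pos t; positivity) (fun t => by positivity)
    (((hαβ.mul_left _).add (hβ_sq.mul_left _)).add (hα_sq.mul_left _))
    ((hβ_sq.mul_left _).add (hα_sq.mul_left _)) (by positivity) ?_ (fun t => ?_) (fun t => ?_)
  · refine le_of_eq ?_
    rw [hε_def]
    field_simp
  · obtain ⟨hξ_int, -, hξ⟩ := h.noise_pairing t
      (y := fun i ω => lazyAverage (β t) (W t) (x t ω) i - weightedMean r (x t ω))
      (fun i => (stronglyMeasurable_lazyAverage (h.x_meas t) i).sub
        (stronglyMeasurable_weightedMean (h.x_meas t)))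
      (fun i => (memLp_lazyAverage (h.memLp t) i).sub (memLp_weightedMean (h.memLp t)))
    have hξ0 := integral_condExp (μ := μ) (F.le t) (f := fun ω => 2 * β t * ∑ i, r i *
      ⟪lazyAverage (β t) (W t) (x t ω) i - weightedMean r (x t ω), e t ω i⟫)
    rw [integral_congr_ae hξ] at hξ0
    simp only [Pi.zero_apply, integral_zero] at hξ0
    have hstep : ∀ ω, dispersion r (x (t + 1) ω) ≤ dispersion r (x t ω)
        - β t / 2 * edgeEnergy r (W t) (x t ω)
        + stepError r α β x e ε (L ^ 2 / ε) (2 * L ^ 2) t ω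
        + 2 * β t * ∑ i, r i *
          ⟪lazyAverage (β t) (W t) (x t ω) i - weightedMean r (x t ω), e t ω i⟫ := fun ω =>
      dispersion_step_le hr h.r_sum (h.W_nonneg t) (h.W_row t) (h.W_r t) (h.α_nonneg t)
        (h.β_pos t) (h.β_le t) (h.g_le t ω) (h.dyn t ω) hε
    have hA := (hdisp t).sub ((hedge t).const_mul (β t / 2))
    have hB := h.integrable_stepError ε (L ^ 2 / ε) (2 * L ^ 2) t
    have hintg := integral_mono (hdisp (t + 1)) ((hA.add hB).add hξ_int) hstep
    have hsplit := integral_add (hA.add hB) hξ_int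
    have hsplit' := integral_add hA hB
    have hsplit'' := integral_sub (hdisp t) ((hedge t).const_mul (β t / 2))
    rw [integral_const_mul] at hsplit''
    simp only [Pi.add_apply, Pi.sub_apply] at hintg hsplit hsplit' hsplit''
    have herr := h.integral_stepError ε (L ^ 2 / ε) (2 * L ^ 2) t
    linarith
  · have hbound : ∀ ω, dispersion r (x (t + B + 1) ω) ≤ C * ∑ k ∈ Finset.range (B + 1),
        (5 * edgeEnergy r (W (t + k)) (x (t + k) ω)
          + 4 * β (t + k) ^ 2 * ∑ i, r i * ‖e (t + k) ω i‖ ^ 2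
          + 2 * L ^ 2 * α (t + k) ^ 2) := by
      intro ω
      refine (hwin (fun t => x t ω) t).trans (mul_le_mul_of_nonneg_left ?_ hC.le)
      refine Finset.sum_le_sum fun k _ => ?_
      have := sum_mul_norm_step_sub_sq_le hr h.r_sum (h.W_nonneg (t + k)) (h.W_row (t + k))
        (h.β_pos (t + k)).le ((h.β_le (t + k)).trans (by norm_num)) (h.g_le (t + k) ω)
        (h.dyn (t + k) ω)
      linarith
    have h1 : ∀ k, Integrable (fun ω => 5 * edgeEnergy r (W (t + k)) (x (t + k) ω)) μ := fun k =>
      (hedge (t + k)).const_mul 5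
    have h2 : ∀ k, Integrable
        (fun ω => 4 * β (t + k) ^ 2 * ∑ i, r i * ‖e (t + k) ω i‖ ^ 2) μ := fun k =>
      (h.integrable_noise_energy (t + k)).const_mul _
    have hintg : ∫ ω, dispersion r (x (t + B + 1) ω) ∂μ ≤ C * ∑ k ∈ Finset.range (B + 1),
        (5 * ∫ ω, edgeEnergy r (W (t + k)) (x (t + k) ω) ∂μ
          + 4 * β (t + k) ^ 2 * ∫ ω, ∑ i, r i * ‖e (t + k) ω i‖ ^ 2 ∂μ
          + c * (2 * L ^ 2 * α (t + k) ^ 2)) := by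
      have hk : ∀ k, Integrable (fun ω => 5 * edgeEnergy r (W (t + k)) (x (t + k) ω)
          + 4 * β (t + k) ^ 2 * ∑ i, r i * ‖e (t + k) ω i‖ ^ 2 + 2 * L ^ 2 * α (t + k) ^ 2) μ :=
        fun k => ((h1 k).add (h2 k)).add (integrable_const _)
      refine (integral_mono (hdisp _) ((integrable_finsetSum _ fun k _ => hk k).const_mul C)
        hbound).trans_eq ?_
      rw [integral_const_mul, integral_finsetSum _ fun k _ => hk k]
      congr 1
      refine Finset.sum_congr rfl fun k _ => ?_
      have h12 : Integrable (fun ω => 5 * edgeEnergy r (W (t + k)) (x (t + k) ω)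
          + 4 * β (t + k) ^ 2 * ∑ i, r i * ‖e (t + k) ω i‖ ^ 2) μ := (h1 k).add (h2 k)
      rw [integral_add h12 (integrable_const _), integral_add (h1 k) (h2 k)]
      simp only [integral_const_mul, integral_const, smul_eq_mul, ← hc]
      ring
    have hβ0 := (h.β_pos (t + B + 1)).le
    refine (mul_le_mul_of_nonneg_left hintg hβ0).trans ?_
    rw [mul_left_comm, mul_comm 5 C, mul_assoc, Finset.mul_sum, Finset.mul_sum (a := (5 : ℝ))]
    refine mul_le_mul_of_nonneg_left (Finset.sum_le_sum fun k hk => ?_) hC.le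
    have hβk : β (t + B + 1) ≤ β (t + k) := hβ_mono (by have := Finset.mem_range.1 hk; omega)
    have hβ1 : β (t + B + 1) ≤ 1 := (h.β_le _).trans (by norm_num)
    have hD : 0 ≤ ∫ ω, edgeEnergy r (W (t + k)) (x (t + k) ω) ∂μ :=
      integral_nonneg fun ω => edgeEnergy_nonneg hr (h.W_nonneg _) _
    have h3 := mul_le_mul_of_nonneg_right hβk hD
    have h4 := mul_le_mul_of_nonneg_left (h.integral_noise_energy_le (t + k))
      (sq_nonneg (β (t + k)))
    have h5 : 0 ≤ ∫ ω, ∑ i, r i * ‖e (t + k) ω i‖ ^ 2 ∂μ :=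
      integral_nonneg fun ω => h.noise_energy_nonneg _ ω
    have h6 : 0 ≤ 4 * β (t + k) ^ 2 * ∫ ω, ∑ i, r i * ‖e (t + k) ω i‖ ^ 2 ∂μ
        + c * (2 * L ^ 2 * α (t + k) ^ 2) := by positivity
    have h7 := mul_le_mul_of_nonneg_right hβ1 h6
    have h8 : 0 ≤ 4 * γ * β (t + k) ^ 2 + c * (2 * L ^ 2) * α (t + k) ^ 2 := by positivity
    linarith

theorem summable_integral_stepError [IsFiniteMeasure μ] (h : NoisyConsensus μ F r W α β L γ x e g)
    (hα_sq : Summable fun t => α t ^ 2) (hβ_sq : Summable fun t => β t ^ 2)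
    (hαβ : Summable fun t => α t ^ 2 / β t)
    (hdisp : Summable fun t => β t * ∫ ω, dispersion r (x t ω) ∂μ) {p q s : ℝ} (hp : 0 ≤ p)
    (hq : 0 ≤ q) (hs : 0 ≤ s) :
    Summable fun t => ∫ ω, stepError r α β x e p q s t ω ∂μ :=
  Summable.of_nonneg_of_le (fun t => integral_nonneg fun ω => h.stepError_nonneg hp hq hs t ω)
    (h.integral_stepError p q s)
    ((((hdisp.mul_left p).add (hαβ.mul_left _)).add (hβ_sq.mul_left _)).add (hα_sq.mul_left _))

theorem ae_tendsto_dispersion [IsFiniteMeasure μ] [CompleteSpace E]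
    (h : NoisyConsensus μ F r W α β L γ x e g)
    (hα_sq : Summable fun t => α t ^ 2) (hβ_sq : Summable fun t => β t ^ 2)
    (hαβ : Summable fun t => α t ^ 2 / β t) (hβ : ¬ Summable β)
    (hdisp : Summable fun t => β t * ∫ ω, dispersion r (x t ω) ∂μ) :
    ∀ᵐ ω ∂μ, Tendsto (fun t => dispersion r (x t ω)) atTop (nhds 0) := by
  have hr : ∀ i, 0 ≤ r i := fun i => (h.r_pos i).le
  have hξ := fun t => h.noise_pairing t
    (y := fun i ω => lazyAverage (β t) (W t) (x t ω) i - weightedMean r (x t ω))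
    (fun i => (stronglyMeasurable_lazyAverage (h.x_meas t) i).sub
      (stronglyMeasurable_weightedMean (h.x_meas t)))
    (fun i => (memLp_lazyAverage (h.memLp t) i).sub (memLp_weightedMean (h.memLp t)))
  have hq : 0 ≤ L ^ 2 / 1 := by positivity
  have hs : 0 ≤ 2 * L ^ 2 := by positivity
  have hlim := ae_summable_and_tendsto_of_le_sub_add (μ := μ) (F := F)
    (a := fun t ω => dispersion r (x t ω))
    (b := fun t ω => β t / 2 * edgeEnergy r (W t) (x t ω))
    (c := fun t ω => stepError r α β x e 1 (L ^ 2 / 1) (2 * L ^ 2) t ω)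
    (ξ := fun t ω => 2 * β t * ∑ i, r i *
      ⟪lazyAverage (β t) (W t) (x t ω) i - weightedMean r (x t ω), e t ω i⟫)
    (fun t ω => dispersion_nonneg hr _)
    (fun t ω => mul_nonneg (half_pos (h.β_pos t)).le (edgeEnergy_nonneg hr (h.W_nonneg t) _))
    (fun t ω => h.stepError_nonneg zero_le_one hq hs t ω)
    (integrable_dispersion (h.memLp 0)) (h.integrable_stepError _ _ _)
    (h.summable_integral_stepError hα_sq hβ_sq hαβ hdisp zero_le_one hq hs)
    (fun t => (hξ t).1) (fun t => (hξ t).2.1) (fun t => (hξ t).2.2)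
    (fun t ω => dispersion_step_le hr h.r_sum (h.W_nonneg t) (h.W_row t) (h.W_r t) (h.α_nonneg t)
        (h.β_pos t) (h.β_le t) (h.g_le t ω) (h.dyn t ω) one_pos)
  have hsum := ae_summable_of_summable_integral (μ := μ)
    (c := fun t ω => β t * dispersion r (x t ω))
    (fun t ω => mul_nonneg (h.β_pos t).le (dispersion_nonneg hr _))
    (fun t => (integrable_dispersion (h.memLp t)).const_mul _)
    (by simpa only [integral_const_mul] using hdisp)
  filter_upwards [hlim, hsum] with ω h1 h2
  obtain ⟨-, l, hl⟩ := h1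
  rwa [eq_zero_of_tendsto_of_summable_mul (fun t => (h.β_pos t).le) hβ h2
    (fun t => dispersion_nonneg hr _) hl] at hl

theorem ae_tendsto_norm_weightedMean_sub [IsFiniteMeasure μ] [CompleteSpace E]
    (h : NoisyConsensus μ F r W α β L γ x e g)
    (hα_sq : Summable fun t => α t ^ 2) (hβ_sq : Summable fun t => β t ^ 2)
    (hαβ : Summable fun t => α t ^ 2 / β t)
    (hdisp : Summable fun t => β t * ∫ ω, dispersion r (x t ω) ∂μ)
    {f : ι → E → ℝ} (hlip : ∀ i p y, f i p - L * ‖y - p‖ ≤ f i y)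
    (hsub : ∀ t ω i y, f i (x t ω i) + ⟪g t ω i, y - x t ω i⟫ ≤ f i y) {z : E}
    (hz : ∀ y, ∑ i, r i * f i z ≤ ∑ i, r i * f i y) :
    ∀ᵐ ω ∂μ, (Summable fun t => 2 * α t *
        (∑ i, r i * f i (weightedMean r (x t ω)) - ∑ i, r i * f i z)) ∧
      ∃ l, Tendsto (fun t => ‖weightedMean r (x t ω) - z‖ ^ 2) atTop (nhds l) := by
  have hr : ∀ i, 0 ≤ r i := fun i => (h.r_pos i).le
  have hy : ∀ t, MemLp (fun ω => weightedMean r (x t ω) - z) 2 μ := fun t =>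
    (memLp_weightedMean (h.memLp t)).sub (memLp_const z)
  have hξ := fun t => h.noise_pairing t
    (y := fun _ ω => weightedMean r (x t ω) - z)
    (fun _ => (stronglyMeasurable_weightedMean (h.x_meas t)).sub stronglyMeasurable_const)
    (fun _ => hy t)
  have hq : 0 ≤ 4 * L ^ 2 := by positivity
  have hs : 0 ≤ 2 * L ^ 2 := by positivity
  refine ae_summable_and_tendsto_of_le_sub_add (μ := μ) (F := F)
    (a := fun t ω => ‖weightedMean r (x t ω) - z‖ ^ 2)
    (c := fun t ω => stepError r α β x e 1 (4 * L ^ 2) (2 * L ^ 2) t ω)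
    (ξ := fun t ω => 2 * β t * ∑ i, r i * ⟪weightedMean r (x t ω) - z, e t ω i⟫)
    (fun t ω => sq_nonneg _)
    (fun t ω => mul_nonneg (mul_nonneg zero_le_two (h.α_nonneg t)) (sub_nonneg.2 (hz _)))
    (fun t ω => h.stepError_nonneg zero_le_one hq hs t ω)
    (hy 0).integrable_norm_sq (h.integrable_stepError _ _ _)
    (h.summable_integral_stepError hα_sq hβ_sq hαβ hdisp zero_le_one hq hs)
    (fun t => (hξ t).1) (fun t => (hξ t).2.1) (fun t => (hξ t).2.2) fun t ω => ?_
  have hstep := norm_weightedMean_step_sub_sq_le hr h.r_sum (h.W_r t) (h.α_nonneg t)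
    (h.β_pos t) (h.g_le t ω) (h.dyn t ω) hlip (hsub t ω) z
  have hinner : ⟪weightedMean r (x t ω) - z, weightedMean r (e t ω)⟫
      = ∑ i, r i * ⟪weightedMean r (x t ω) - z, e t ω i⟫ := by
    simp only [weightedMean, inner_sum, real_inner_smul_right]
  rw [hinner] at hstep
  simp only [stepError, one_mul]
  exact hstep

/-- Almost sure convergence of all agents to a common minimizer of the weighted objective. -/
theorem ae_exists_tendsto [IsFiniteMeasure μ] [FiniteDimensional ℝ E] [Nonempty ι]
    (h : NoisyConsensus μ F r W α β L γ x e g)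
    {η : ℝ} (hη : 0 < η) {B : ℕ} (hWη : ∀ t i j, W t i j ≠ 0 → η ≤ W t i j)
    (hconn : ∀ (t : ℕ) (u v : ι), Relation.ReflTransGen
      (fun u v => ∃ k, t + 1 ≤ k ∧ k ≤ t + B ∧ 0 < W k v u) u v)
    (hβ_mono : Antitone β) (hα_sq : Summable fun t => α t ^ 2)
    (hβ_sq : Summable fun t => β t ^ 2) (hαβ : Summable fun t => α t ^ 2 / β t)
    (hα : ¬ Summable α) (hβ : ¬ Summable β) {f : ι → E → ℝ} (hf : ∀ i, Continuous (f i))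
    (hlip : ∀ i p y, f i p - L * ‖y - p‖ ≤ f i y)
    (hsub : ∀ t ω i y, f i (x t ω i) + ⟪g t ω i, y - x t ω i⟫ ≤ f i y)
    (hopt : ∃ z, ∀ y, ∑ i, r i * f i z ≤ ∑ i, r i * f i y) :
    ∀ᵐ ω ∂μ, ∃ xt : E, (∀ y, ∑ i, r i * f i xt ≤ ∑ i, r i * f i y) ∧
      ∀ i, Tendsto (fun t => x t ω i) atTop (nhds xt) := by
  have : CompleteSpace E := FiniteDimensional.complete ℝ E
  have : ProperSpace E := FiniteDimensional.proper ℝ E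
  have hdisp := h.summable_integral_dispersion hη hWη hconn hβ_mono hα_sq hβ_sq hαβ
  obtain ⟨z₀, hz₀⟩ := hopt
  obtain ⟨S, hSsub, hSc, hSd⟩ := (TopologicalSpace.IsSeparable.of_separableSpace
    {z : E | ∀ y, ∑ i, r i * f i z ≤ ∑ i, r i * f i y}).exists_countable_dense_subset
  have hS'c : (insert z₀ S).Countable := hSc.insert z₀
  have hS'sub : ∀ z ∈ insert z₀ S, ∀ y, ∑ i, r i * f i z ≤ ∑ i, r i * f i y := by
    rintro z (rfl | hz)
    exacts [hz₀, hSsub hz]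
  have hall := (ae_ball_iff hS'c).2 fun z hz =>
    h.ae_tendsto_norm_weightedMean_sub hα_sq hβ_sq hαβ hdisp hlip hsub (hS'sub z hz)
  filter_upwards [hall, h.ae_tendsto_dispersion hα_sq hβ_sq hαβ hβ hdisp] with ω h1 h2
  have hsum₀ := (h1 z₀ (Set.mem_insert _ _)).1
  have hα2 : ¬ Summable fun t => 2 * α t := fun hs =>
    hα ((summable_mul_left_iff (two_ne_zero (α := ℝ))).1 hs)
  obtain ⟨xt, hxt, hlim⟩ := exists_tendsto_minimizer (Φ := fun y => ∑ i, r i * f i y)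
    (continuous_finsetSum _ fun i _ => (hf i).const_mul (r i)) (Set.mem_insert z₀ S) hz₀
    (hSd.trans (closure_mono (Set.subset_insert _ _))) (x := fun t => weightedMean r (x t ω))
    (fun z hz => (h1 z hz).2) fun ε hε => frequently_lt_of_summable_mul
      (fun t => mul_nonneg zero_le_two (h.α_nonneg t)) hα2 hsum₀ hε
  refine ⟨xt, hxt, fun i => ?_⟩
  have hzero : Tendsto (fun t => x t ω i - weightedMean r (x t ω)) atTop (nhds 0) := by
    rw [tendsto_zero_iff_norm_tendsto_zero]
    have hlim' : Tendsto (fun t => √((r i)⁻¹ * dispersion r (x t ω))) atTop (nhds 0) := by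
      simpa using (h2.const_mul (r i)⁻¹).sqrt
    refine squeeze_zero (fun t => norm_nonneg _) (fun t => ?_) hlim'
    refine Real.le_sqrt_of_sq_le ?_
    rw [inv_mul_eq_div, le_div_iff₀ (h.r_pos i), mul_comm]
    exact Finset.single_le_sum (f := fun j => r j * ‖x t ω j - weightedMean r (x t ω)‖ ^ 2)
      (fun j _ => mul_nonneg (h.r_pos j).le (sq_nonneg _)) (Finset.mem_univ i)
  simpa using hzero.add hlim

end NoisyConsensus

end NoisyConsensus

theorem not_summable_of_summable_sq_div {α β : ℕ → ℝ} (hα : ¬ Summable α) (hα0 : ∀ t, 0 ≤ α t)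
    (hβ : ∀ t, 0 < β t) (hαβ : Summable fun t => α t ^ 2 / β t) : ¬ Summable β := by
  intro hs
  refine hα (Summable.of_nonneg_of_le hα0 (fun t => ?_) (hαβ.add hs))
  have hb := hβ t
  rw [div_add' _ _ _ hb.ne', le_div_iff₀ hb]
  nlinarith [sq_nonneg (α t - β t), mul_nonneg (hα0 t) hb.le]

theorem pos_of_step_conditions {α β : ℕ → ℝ} (hα_mono : Antitone α) (hβ_mono : Antitone β)
    (hβ_mem : ∀ t, 0 ≤ β t ∧ β t ≤ 1) (hα_div : ¬ Summable α)
    (hα_sq : Summable fun t => α t ^ 2) {t₀ : ℕ} {c₁ c₂ : ℝ} (hc₁ : c₁ < 1)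
    (hstep : ∀ t, t₀ ≤ t → β t - β (t + 1) ≤ c₁ * β t ^ 2 ∧
      α t - α (t + 1) ≤ c₂ * (α t * β t)) (t : ℕ) : 0 < β t := by
  have h0 : 0 < β t₀ := by
    refine (hβ_mem t₀).1.lt_of_ne fun h => hα_div ?_
    have hβ0 : ∀ t, t₀ ≤ t → β t = 0 := fun t ht =>
      le_antisymm (h ▸ hβ_mono ht) (hβ_mem t).1
    have hconst : ∀ t, t₀ ≤ t → α t = α t₀ := by
      intro t ht
      induction t, ht using Nat.le_induction with
      | base => rfl
      | succ t ht ih =>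
        have h1 := (hstep t ht).2
        rw [hβ0 t ht] at h1
        have h2 := hα_mono (Nat.le_succ t)
        simp only [Nat.succ_eq_add_one] at h2
        linarith
    have hlim : Tendsto (fun t => α t ^ 2) atTop (nhds (α t₀ ^ 2)) :=
      tendsto_const_nhds.congr' (by
        filter_upwards [eventually_ge_atTop t₀] with t ht
        rw [hconst t ht])
    have hzero : α t₀ = 0 :=
      pow_eq_zero_iff two_ne_zero |>.1 (tendsto_nhds_unique hlim hα_sq.tendsto_atTop_zero)
    rw [← summable_nat_add_iff t₀]
    refine summable_zero.congr fun t => ?_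
    rw [hconst _ (Nat.le_add_left _ _), hzero]
  have hpos : ∀ t, t₀ ≤ t → 0 < β t := by
    intro t ht
    induction t, ht using Nat.le_induction with
    | base => exact h0
    | succ t ht ih =>
      have h1 := (hstep t ht).1
      have h2 := (hβ_mem t).2
      nlinarith [mul_pos ih ih, mul_nonneg ih.le (sub_nonneg.2 h2),
        mul_pos (sub_pos.2 hc₁) (mul_pos ih ih)]
  rcases le_total t₀ t with ht | ht
  exacts [hpos t ht, h0.trans_le (hβ_mono ht)]

/-- The shift of a filtration by `s` time steps. -/
def MeasureTheory.Filtration.shift {Ω : Type*} {m0 : MeasurableSpace Ω} (F : Filtration ℕ m0)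
    (s : ℕ) : Filtration ℕ m0 where
  seq t := F (t + s)
  mono' _ _ h := F.mono (Nat.add_le_add_right h s)
  le' t := F.le (t + s)

theorem integral_restrict_le_of_condExp_le {Ω : Type*} {m m0 : MeasurableSpace Ω} {μ : Measure Ω}
    [IsProbabilityMeasure μ] (hm : m ≤ m0) {u : Ω → ℝ} (hu0 : ∀ ω, 0 ≤ u ω) (hu : Integrable u μ)
    {γ : ℝ} (hγ : ∀ᵐ ω ∂μ, (μ[u|m]) ω ≤ γ) (A : Set Ω) : ∫ ω in A, u ω ∂μ ≤ γ := by
  refine (setIntegral_le_integral hu (ae_of_all _ hu0)).trans ?_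
  rw [← integral_condExp hm]
  refine (integral_mono_ae integrable_condExp (integrable_const γ) hγ).trans_eq ?_
  simp

theorem stmt_0 {Ω : Type*} {m0 : MeasurableSpace Ω} (μ : Measure Ω) [IsProbabilityMeasure μ]
    (n d : ℕ) (hn : 2 ≤ n)
    -- the strictly positive stochastic weight vector r
    (r : Fin n → ℝ) (hr_pos : ∀ i, 0 < r i) (hr_sum : ∑ i, r i = 1)
    -- Assumption 3: local objective functions
    (f : Fin n → EuclideanSpace ℝ (Fin d) → ℝ)
    (hf_convex : ∀ i, ConvexOn ℝ Set.univ (f i))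
    (L : ℝ) (hL : 0 < L)
    (hf_subgrad_bound : ∀ (i : Fin n) (p v : EuclideanSpace ℝ (Fin d)),
      (∀ y, f i p + ⟪v, y - p⟫ ≤ f i y) → ‖v‖ < L)
    (hopt_nonempty : ∃ z : EuclideanSpace ℝ (Fin d),
      ∀ y, ∑ i, r i * f i z ≤ ∑ i, r i * f i y)
    -- Assumption 2: connectivity of the time-varying weight matrices
    (W : ℕ → Matrix (Fin n) (Fin n) ℝ) (η : ℝ) (hη : 0 < η) (B : ℕ) (hB : 1 ≤ B)
    (hW_nonneg : ∀ t i j, 0 ≤ W t i j)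
    (hW_row : ∀ t i, ∑ j, W t i j = 1)
    (hW_r : ∀ t j, ∑ i, r i * W t i j = r j)
    (hW_eta : ∀ t i j, W t i j ≠ 0 → η ≤ W t i j)
    (hW_conn : ∀ t : ℕ, ∀ a b : Fin n,
      Relation.ReflTransGen
        (fun u v : Fin n => ∃ k, t + 1 ≤ k ∧ k ≤ t + B ∧ 0 < W k v u) a b)
    -- Assumption 4: step-size sequences
    (α β : ℕ → ℝ)
    (hα_nonneg : ∀ t, 0 ≤ α t) (hα_mono : Antitone α) (hβ_mono : Antitone β)
    (hβ_mem : ∀ t, 0 ≤ β t ∧ β t ≤ 1)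
    (hα_div : ¬ Summable α)
    (hα_sq : Summable (fun t => α t ^ 2))
    (hβ_sq : Summable (fun t => β t ^ 2))
    (hαβ : Summable (fun t => α t ^ 2 / β t))
    (hstep : ∃ t₀ : ℕ, 1 ≤ t₀ ∧ ∃ c₁ c₂ : ℝ,
      0 < c₁ ∧ c₁ < (η * (⨅ i, r i) / (2 * B * n ^ 2)) / 2 ∧
      0 < c₂ ∧ c₂ < (η * (⨅ i, r i) / (2 * B * n ^ 2)) / 4 ∧
      ∀ t, t₀ ≤ t → β t - β (t + 1) ≤ c₁ * β t ^ 2 ∧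
        α t - α (t + 1) ≤ c₂ * (α t * β t))
    -- the stochastic processes: states, noise, subgradients
    (F : Filtration ℕ m0)
    (x e g : ℕ → Ω → Fin n → EuclideanSpace ℝ (Fin d))
    (hx_adapted : Adapted F x) (hg_adapted : Adapted F g)
    (he_meas : ∀ t, AEStronglyMeasurable (e t) μ)
    (he_int : ∀ t i, Integrable (fun ω => e t ω i) μ)
    (he_sq_int : ∀ t i, Integrable (fun ω => ‖e t ω i‖ ^ 2) μ)
    -- Assumption 1: noise
    (γ : ℝ) (hγ : 0 < γ)
    (hnoise_mean : ∀ t i, μ[fun ω => e t ω i|F t] =ᵐ[μ] 0)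
    (hnoise_var : ∀ t i, ∀ᵐ ω ∂μ, (μ[fun ω' => ‖e t ω' i‖ ^ 2|F t]) ω ≤ γ)
    -- g t ω i is a subgradient of f i at x t ω i
    (hsubgrad : ∀ t ω i, ∀ y, f i (x t ω i) + ⟪g t ω i, y - x t ω i⟫ ≤ f i y)
    -- the two-time-scale dynamics
    (hdyn : ∀ t ω i, x (t + 1) ω i =
      (1 - β t) • x t ω i + β t • ((∑ j, W t i j • x t ω j) + e t ω i)
        - α t • g t ω i) :
    ∀ᵐ ω ∂μ, ∃ xt : EuclideanSpace ℝ (Fin d),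
      (∀ y, ∑ i, r i * f i xt ≤ ∑ i, r i * f i y) ∧
      ∀ i, Tendsto (fun t => x t ω i) atTop (nhds xt) := by
  have hne : Nonempty (Fin n) := ⟨⟨0, by omega⟩⟩
  have hnR : (2 : ℝ) ≤ n := by exact_mod_cast hn
  have hBR : (1 : ℝ) ≤ B := by exact_mod_cast hB
  have hβ_pos : ∀ t, 0 < β t := by
    obtain ⟨t₀, -, c₁, c₂, -, hc₁, -, -, hst⟩ := hstep
    refine pos_of_step_conditions hα_mono hβ_mono hβ_mem hα_div hα_sq
      (hc₁.trans ?_) hst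
    obtain ⟨i₀⟩ := hne
    have hη1 : η ≤ 1 := by
      obtain ⟨j, -, hj⟩ := Finset.exists_ne_zero_of_sum_ne_zero
        ((hW_row 0 i₀).trans_ne one_ne_zero)
      refine (hW_eta 0 i₀ j hj).trans ((hW_row 0 i₀).le.trans' ?_)
      exact Finset.single_le_sum (f := fun j => W 0 i₀ j) (fun j _ => hW_nonneg 0 i₀ j)
        (Finset.mem_univ j)
    have hr1 : ⨅ i, r i ≤ 1 := by
      refine (ciInf_le (Set.finite_range r).bddBelow i₀).trans (hr_sum.le.trans' ?_)
      exact Finset.single_le_sum (fun j _ => (hr_pos j).le) (Finset.mem_univ i₀)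
    have hr0 : 0 ≤ ⨅ i, r i := Real.iInf_nonneg fun i => (hr_pos i).le
    have hnum : η * (⨅ i, r i) ≤ 1 := mul_le_one₀ hη1 hr0 hr1
    have hn2 : (1 : ℝ) ≤ (n : ℝ) ^ 2 := one_le_pow₀ (by linarith)
    have hden : (1 : ℝ) ≤ 2 * B * n ^ 2 := by nlinarith
    rw [div_div, div_lt_one (by positivity)]
    linarith
  have hβ_div := not_summable_of_summable_sq_div hα_div hα_nonneg hβ_pos hαβ
  obtain ⟨s, hs⟩ : ∃ s, ∀ t, s ≤ t → β t ≤ 1 / 2 := by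
    have h1 := hβ_sq.tendsto_atTop_zero.eventually_le_const (show (0 : ℝ) < 1 / 4 by norm_num)
    obtain ⟨s, hs⟩ := eventually_atTop.1 h1
    exact ⟨s, fun t ht => by nlinarith [hs t ht, (hβ_mem t).1]⟩
  have hx_meas : ∀ t i, StronglyMeasurable[F t] fun ω => x t ω i := fun t i =>
    ((measurable_pi_apply i).comp (hx_adapted t)).stronglyMeasurable
  have hg_meas : ∀ t i, StronglyMeasurable[F t] fun ω => g t ω i := fun t i =>
    ((measurable_pi_apply i).comp (hg_adapted t)).stronglyMeasurable
  let A : ℕ → Set Ω := fun K => {ω | ∀ i, ‖x s ω i‖ ≤ K}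
  have hA_meas : ∀ K, MeasurableSet[F s] (A K) := by
    intro K
    have hA : A K = ⋂ i, {ω | ‖x s ω i‖ ≤ K} := by
      ext ω
      simp [A]
    rw [hA]
    exact MeasurableSet.iInter fun i =>
      (hx_meas s i).norm.measurableSet_le stronglyMeasurable_const
  have hA_univ : ⋃ K, A K = Set.univ := by
    refine Set.eq_univ_of_forall fun ω => Set.mem_iUnion.2 ?_
    obtain ⟨K, hK⟩ := exists_nat_ge (∑ i, ‖x s ω i‖)
    exact ⟨K, fun i => (Finset.single_le_sum (f := fun i => ‖x s ω i‖)
      (fun j _ => norm_nonneg _) (Finset.mem_univ i)).trans hK⟩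
  have hsystem : ∀ K, NoisyConsensus (μ.restrict (A K)) (F.shift s) r (fun t => W (t + s))
      (fun t => α (t + s)) (fun t => β (t + s)) L γ (fun t => x (t + s)) (fun t => e (t + s))
      (fun t => g (t + s)) := by
    intro K
    have hA_F : ∀ t, MeasurableSet[F (t + s)] (A K) := fun t =>
      F.mono (Nat.le_add_left s t) _ (hA_meas K)
    exact
      { r_pos := hr_pos
        r_sum := hr_sum
        W_nonneg := fun t => hW_nonneg _
        W_row := fun t => hW_row _
        W_r := fun t => hW_r _
        α_nonneg := fun t => hα_nonneg _
        β_pos := fun t => hβ_pos _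
        β_le := fun t => hs _ (Nat.le_add_left s t)
        γ_nonneg := hγ.le
        g_le := fun t ω i => (hf_subgrad_bound i _ _ (hsubgrad _ ω i)).le
        x_meas := fun t => hx_meas _
        g_meas := fun t => hg_meas _
        x_zero_memLp := fun i => by
          refine MemLp.of_bound ((hx_meas (0 + s) i).mono (F.le _)).aestronglyMeasurable K ?_
          refine (ae_restrict_mem (F.le s _ (hA_meas K))).mono fun ω hω => ?_
          simpa using hω i
        e_memLp := fun t i => ((memLp_two_iff_integrable_sq_norm (he_int _ i).1).2
          (he_sq_int _ i)).restrict _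
        e_mean := fun t i => (condExp_restrict_ae_eq_restrict (F.le (t + s)) (hA_F t)
          (he_int _ i)).trans (ae_restrict_of_ae (hnoise_mean _ i))
        e_var := fun t i => integral_restrict_le_of_condExp_le (F.le (t + s))
          (fun ω => sq_nonneg _) (he_sq_int _ i) (hnoise_var _ i) _
        dyn := fun t ω i => by
          have hsucc : t + 1 + s = t + s + 1 := by omega
          simp only [hsucc, hdyn (t + s) ω i, lazyAverage, smul_add]
          abel }
  have hcore : ∀ K, ∀ᵐ ω ∂μ.restrict (A K), ∃ xt : EuclideanSpace ℝ (Fin d),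
      (∀ y, ∑ i, r i * f i xt ≤ ∑ i, r i * f i y) ∧
      ∀ i, Tendsto (fun t => x (t + s) ω i) atTop (nhds xt) := by
    intro K
    refine (hsystem K).ae_exists_tendsto hη (B := B) (fun t => hW_eta _) (fun t u v => ?_)
      (fun _ _ h => hβ_mono (Nat.add_le_add_right h s))
      ((summable_nat_add_iff s).2 hα_sq) ((summable_nat_add_iff s).2 hβ_sq)
      ((summable_nat_add_iff s).2 hαβ) (fun h => hα_div ((summable_nat_add_iff s).1 h))
      (fun h => hβ_div ((summable_nat_add_iff s).1 h))
      (fun i => (hf_convex i).locallyLipschitz.continuous)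
      (fun i => (hf_convex i).sub_mul_norm_le_of_subgradient_lt (hf_subgrad_bound i))
      (fun t => hsubgrad _) hopt_nonempty
    refine Relation.ReflTransGen.mono ?_ u v (hW_conn (t + s) u v)
    rintro u v ⟨k, hk1, hk2, hk⟩
    exact ⟨k - s, by omega, by omega, by rwa [Nat.sub_add_cancel (by omega)]⟩
  have hae := (ae_restrict_iUnion_iff (μ := μ) A _).2 hcore
  rw [hA_univ, Measure.restrict_univ] at hae
  filter_upwards [hae] with ω hω
  obtain ⟨xt, hxt, hlim⟩ := hω
  exact ⟨xt, hxt, fun i => (tendsto_add_atTop_iff_nat s).1 (hlim i)⟩
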